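/- Let W be a simply laced Weyl group (type A, D, or E). Assume: (i) every Bruhat interval in W which is a zircon is isomorphic as a poset to a lower Bruhat interval in some Weyl group; and (ii) for every rationally smooth Bruhat interval [u,w] in W, the dual [u,w]* is a zircon. Then for all u < w in W the following are equivalent: (1) [u,w]* is a zircon; (2) [u,w]* is isomorphic to some lower Bruhat interval in some Weyl group; (3) [u,w] is rationally smooth. -/

import Mathlib

namespace Paper

/-! ### Bruhat order on a Coxeter group -/

variable {B W : Type*} [Group W] {M : CoxeterMatrix B}

/-- One step in the Bruhat order: multiply on the left by a reflection,
increasing the length. -/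
def BruhatStep (cs : CoxeterSystem M W) (a b : W) : Prop :=
  ∃ t : W, cs.IsReflection t ∧ b = t * a ∧ cs.length a < cs.length b

/-- The Bruhat order on a Coxeter group. -/
def BruhatLE (cs : CoxeterSystem M W) : W → W → Prop :=
  Relation.ReflTransGen (BruhatStep cs)

theorem BruhatLE.length_le {cs : CoxeterSystem M W} {a b : W} (h : BruhatLE cs a b) :
    cs.length a ≤ cs.length b := by
  induction h with
  | refl => exact le_rfl
  | tail _ h ih => obtain ⟨t, -, -, hlt⟩ := h; exact ih.trans hlt.le

theorem BruhatLE.length_lt {cs : CoxeterSystem M W} {a b : W} (h : BruhatLE cs a b)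
    (hne : a ≠ b) : cs.length a < cs.length b := by
  rcases Relation.ReflTransGen.cases_head h with h' | ⟨c, hc, h'⟩
  · exact absurd h' hne
  · obtain ⟨t, -, -, hlt⟩ := hc
    exact lt_of_lt_of_le hlt (BruhatLE.length_le h')

theorem BruhatLE.antisymm {cs : CoxeterSystem M W} {a b : W} (h1 : BruhatLE cs a b)
    (h2 : BruhatLE cs b a) : a = b := by
  by_contra hne
  exact absurd (BruhatLE.length_lt h1 hne) (not_lt.mpr (BruhatLE.length_le h2))

/-- The Bruhat interval `[u,w]`, as a type. -/
abbrev BruhatInterval (cs : CoxeterSystem M W) (u w : W) : Type _ :=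
  {y : W // BruhatLE cs u y ∧ BruhatLE cs y w}

/-- The Bruhat interval `[u,w]` is a poset under the Bruhat order. -/
instance (cs : CoxeterSystem M W) (u w : W) : PartialOrder (BruhatInterval cs u w) where
  le a b := BruhatLE cs a.1 b.1
  le_refl _ := Relation.ReflTransGen.refl
  le_trans _ _ _ := Relation.ReflTransGen.trans
  le_antisymm _ _ h1 h2 := Subtype.ext (BruhatLE.antisymm h1 h2)

/-- A principal order ideal `{v : v ≤ x}` of the Bruhat order, as a type. -/
abbrev BruhatIdeal (cs : CoxeterSystem M W) (x : W) : Type _ :=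
  {v : W // BruhatLE cs v x}

/-- A principal order ideal of the Bruhat order is a poset under the Bruhat order. -/
instance (cs : CoxeterSystem M W) (x : W) : PartialOrder (BruhatIdeal cs x) where
  le a b := BruhatLE cs a.1 b.1
  le_refl _ := Relation.ReflTransGen.refl
  le_trans _ _ _ := Relation.ReflTransGen.trans
  le_antisymm _ _ h1 h2 := Subtype.ext (BruhatLE.antisymm h1 h2)

/-! ### Posets: matchings, special matchings and zircons -/

/-- A matching of a poset: an involution matching each element with an element
covering it or covered by it. -/
def IsMatching {α : Type*} [PartialOrder α] (f : α → α) : Prop :=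
  Function.Involutive f ∧ ∀ x : α, f x ⋖ x ∨ x ⋖ f x

/-- A special matching of a poset. -/
def IsSpecialMatching {α : Type*} [PartialOrder α] (f : α → α) : Prop :=
  IsMatching f ∧ ∀ x y : α, x ⋖ y → f x = y ∨ f x < f y

/-- A zircon: a poset in which the principal order ideal of every non-minimal element is
finite and has a special matching. -/
def IsZircon (α : Type*) [PartialOrder α] : Prop :=
  ∀ x : α, (∃ y : α, y < x) →
    ({v : α | v ≤ x}.Finite ∧
      ∃ f : {v : α // v ≤ x} → {v : α // v ≤ x}, IsSpecialMatching f)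

/-- The degree of `v` in the Bruhat graph of the interval `[u,w]`: the number of `y ∈ [u,w]`
such that `v⁻¹ * y` is a reflection. -/
noncomputable def bruhatDeg (cs : CoxeterSystem M W) (u w v : W) : ℕ :=
  Nat.card {y : W // (BruhatLE cs u y ∧ BruhatLE cs y w) ∧ cs.IsReflection (v⁻¹ * y)}

/-- A Bruhat interval `[u,w]` is rationally smooth if `deg_{y,w}(y) = ℓ(w) - ℓ(y)` for all
`y ∈ [u,w]` (Carrell–Peterson). -/
def RationallySmooth (cs : CoxeterSystem M W) (u w : W) : Prop :=
  ∀ y : W, BruhatLE cs u y → BruhatLE cs y w →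
    bruhatDeg cs y w y = cs.length w - cs.length y

/-- Bundled data of a Weyl group: a finite crystallographic Coxeter system. -/
structure WeylGroupData where
  {B : Type}
  {W : Type}
  [grp : Group W]
  [fin : Finite W]
  {M : CoxeterMatrix B}
  cs : CoxeterSystem M W
  crys : ∀ i j : B, i ≠ j → M i j ∈ ({2, 3, 4, 6} : Set ℕ)

attribute [instance] WeylGroupData.grp WeylGroupData.fin

/-- The poset `P` is isomorphic to a lower Bruhat interval `[e,x]` in some Weyl group. -/
def IsoToLowerWeylInterval (P : Type*) [PartialOrder P] : Prop :=
  ∃ (D : WeylGroupData) (x : D.W), x ≠ 1 ∧ Nonempty (P ≃o BruhatInterval D.cs 1 x)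

/-! ### Transport of zircons along order isomorphisms -/

theorem IsSpecialMatching.conj {α β : Type*} [PartialOrder α] [PartialOrder β] {f : α → α}
    (hf : IsSpecialMatching f) (e : α ≃o β) :
    IsSpecialMatching (fun b => e (f (e.symm b))) := by
  obtain ⟨⟨hinv, hcov⟩, hsp⟩ := hf
  refine ⟨⟨fun b => by simp [hinv (e.symm b)], fun b => ?_⟩, fun a b hab => ?_⟩
  · rcases hcov (e.symm b) with h | h
    · left; simpa using (apply_covBy_apply_iff e).2 h
    · right; simpa using (apply_covBy_apply_iff e).2 h
  · rcases hsp _ _ ((apply_covBy_apply_iff e.symm).2 hab) with h | h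
    · left; simp [h]
    · right; exact e.lt_iff_lt.2 h

/-- An order isomorphism restricts to principal order ideals. -/
def idealIso {α β : Type*} [PartialOrder α] [PartialOrder β] (e : α ≃o β) (x : α) :
    {v : α // v ≤ x} ≃o {v : β // v ≤ e x} where
  toEquiv := e.toEquiv.subtypeEquiv fun a => (e.le_iff_le (x := a) (y := x)).symm
  map_rel_iff' := by
    intro a b
    exact e.le_iff_le

theorem IsZircon.of_orderIso {α β : Type*} [PartialOrder α] [PartialOrder β]
    (h : IsZircon α) (e : α ≃o β) : IsZircon β := by
  intro x hx
  obtain ⟨x, rfl⟩ := e.surjective x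
  obtain ⟨y, hy⟩ := hx
  obtain ⟨hfin, f, hf⟩ := h x ⟨e.symm y, by simpa using e.symm.lt_iff_lt.2 hy⟩
  refine ⟨?_, _, hf.conj (idealIso e x)⟩
  refine (hfin.image e).subset fun b hb => ⟨e.symm b, ?_, by simp⟩
  have : e.symm b ≤ e.symm (e x) := e.symm.le_iff_le.2 hb
  simpa using this

/-! ### The exchange property -/

section Exchange

variable (cs : CoxeterSystem M W)

open Classical in
/-- The action of a simple reflection on signed group elements, the sign being flipped
exactly at that simple reflection. -/
noncomputable def signedAct (i : B) : Function.End (W × ZMod 2) :=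
  fun p => (cs.simple i * p.1 * cs.simple i, p.2 + if p.1 = cs.simple i then 1 else 0)

open Classical in
theorem signedAct_mul_pow (i j : B) (k : ℕ) (p : W × ZMod 2) :
    ((signedAct cs i * signedAct cs j) ^ k) p =
      ((cs.simple i * cs.simple j) ^ k * p.1 * ((cs.simple i * cs.simple j) ^ k)⁻¹,
        p.2 + ∑ l ∈ Finset.range (2 * k),
          if p.1 = cs.simple j * (cs.simple i * cs.simple j) ^ l then 1 else 0) := by
  induction k with
  | zero => simp; rfl
  | succ k ih =>
    rw [pow_succ']
    change (signedAct cs i) ((signedAct cs j) (((signedAct cs i * signedAct cs j) ^ k) p)) = _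
    rw [ih]
    set c := cs.simple i * cs.simple j with hc
    have hj : ∀ n : ℕ, c ^ n * cs.simple j * c ^ n = cs.simple j := by
      intro n
      induction n with
      | zero => simp
      | succ n ihn =>
        rw [pow_succ]
        nth_rewrite 2 [← pow_succ]
        rw [pow_succ']
        calc c ^ n * c * cs.simple j * (c * c ^ n)
            = c ^ n * (c * cs.simple j * c) * c ^ n := by group
          _ = _ := by rw [hc]; simp [mul_assoc] at ihn ⊢; exact ihn
    have h1 : c ^ k * p.1 * (c ^ k)⁻¹ = cs.simple j ↔ p.1 = cs.simple j * c ^ (2 * k) := by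
      constructor
      · intro h
        have : p.1 = (c ^ k)⁻¹ * cs.simple j * c ^ k := by rw [← h]; group
        rw [this, two_mul, pow_add, ← mul_assoc]
        nth_rewrite 1 [← hj k]
        group
      · intro h
        rw [h, two_mul, pow_add]
        calc _ = c ^ k * cs.simple j * c ^ k := by group
          _ = _ := hj k
    have h2 : cs.simple j * (c ^ k * p.1 * (c ^ k)⁻¹) * cs.simple j = cs.simple i ↔
        p.1 = cs.simple j * c ^ (2 * k + 1) := by
      have e1 : cs.simple j * (c ^ k * p.1 * (c ^ k)⁻¹) * cs.simple j = cs.simple i ↔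
          c ^ k * p.1 * (c ^ k)⁻¹ = cs.simple j * c := by
        constructor
        · intro h
          calc _ = cs.simple j * (cs.simple j * (c ^ k * p.1 * (c ^ k)⁻¹) * cs.simple j) *
                cs.simple j := by simp [mul_assoc]
            _ = _ := by rw [h, hc, mul_assoc]
        · intro h; rw [h, hc]; simp [mul_assoc]
      rw [e1]
      constructor
      · intro h
        have : p.1 = (c ^ k)⁻¹ * (cs.simple j * c) * c ^ k := by rw [← h]; group
        rw [this, pow_succ, two_mul, pow_add]
        nth_rewrite 1 [← hj k]
        simp only [mul_assoc, inv_mul_cancel_left, ← pow_succ]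
        rw [← pow_add, ← pow_add, Nat.add_comm]
      · intro h
        rw [h, pow_succ, two_mul, pow_add]
        calc _ = c ^ k * cs.simple j * c ^ k * c := by
              simp only [mul_assoc, ← pow_succ]
              group
          _ = _ := by rw [hj k]
    rw [Nat.mul_succ, Finset.sum_range_succ, Finset.sum_range_succ]
    simp only [signedAct, h1, h2, Prod.mk.injEq]
    refine ⟨?_, by ring⟩
    rw [pow_succ', hc]
    simp [mul_assoc]

theorem signedAct_isLiftable : M.IsLiftable (signedAct cs) := by
  classical
  intro i j
  funext p
  rw [signedAct_mul_pow, cs.simple_mul_simple_pow, two_mul, Finset.sum_range_add]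
  simp only [pow_add, cs.simple_mul_simple_pow, one_mul, CharTwo.add_self_eq_zero]
  simp
  rfl

/-- The action of the Coxeter group on signed group elements. -/
noncomputable def signedRep : W →* Function.End (W × ZMod 2) :=
  cs.lift ⟨signedAct cs, signedAct_isLiftable cs⟩

theorem signedRep_simple (i : B) : signedRep cs (cs.simple i) = signedAct cs i :=
  cs.lift_apply_simple _ i

/-- The sign change of `t` under the action of `w`. -/
noncomputable def signFlip (w t : W) : ZMod 2 := (signedRep cs w (t, 0)).2

theorem signedRep_wordProd (ω : List B) (p : W × ZMod 2) [DecidableEq W] :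
    signedRep cs (cs.wordProd ω) p =
      (cs.wordProd ω * p.1 * (cs.wordProd ω)⁻¹, p.2 + ((cs.rightInvSeq ω).count p.1 : ZMod 2)) := by
  induction ω with
  | nil => simp; rfl
  | cons i ω ih =>
    rw [cs.wordProd_cons, map_mul, signedRep_simple]
    change signedAct cs i (signedRep cs (cs.wordProd ω) p) = _
    rw [ih]
    simp only [signedAct, CoxeterSystem.rightInvSeq, List.count_cons, Prod.mk.injEq]
    refine ⟨by simp [mul_assoc], ?_⟩
    have : (cs.wordProd ω * p.1 * (cs.wordProd ω)⁻¹ = cs.simple i) ↔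
        ((cs.wordProd ω)⁻¹ * cs.simple i * cs.wordProd ω = p.1) := by
      constructor
      · intro h; rw [← h]; group
      · intro h; rw [← h]; group
    simp only [this, beq_iff_eq]
    push_cast
    rw [add_assoc]

theorem signedRep_apply (w : W) (p : W × ZMod 2) :
    signedRep cs w p = (w * p.1 * w⁻¹, p.2 + signFlip cs w p.1) := by
  classical
  obtain ⟨ω, rfl⟩ := cs.wordProd_surjective w
  simp [signFlip, signedRep_wordProd]

theorem signFlip_mul (x y t : W) :
    signFlip cs (x * y) t = signFlip cs y t + signFlip cs x (y * t * y⁻¹) := by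
  have : signedRep cs (x * y) (t, 0) = signedRep cs x (signedRep cs y (t, 0)) := by
    rw [map_mul]; rfl
  rw [signedRep_apply, signedRep_apply, signedRep_apply] at this
  simpa using congrArg Prod.snd this

theorem signFlip_one (t : W) : signFlip cs 1 t = 0 := by
  simp only [signFlip, map_one]; rfl

open Classical in
theorem signFlip_simple (i : B) (t : W) :
    signFlip cs (cs.simple i) t = if t = cs.simple i then 1 else 0 := by
  simp [signFlip, signedRep_simple, signedAct]

theorem signFlip_self {t : W} (ht : cs.IsReflection t) : signFlip cs t t = 1 := by
  obtain ⟨u, i, rfl⟩ := ht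
  have h1 : signFlip cs (u⁻¹ * u) (cs.simple i) = 0 := by
    rw [inv_mul_cancel, signFlip_one]
  rw [signFlip_mul] at h1
  rw [signFlip_mul, signFlip_mul]
  have e1 : u⁻¹ * (u * cs.simple i * u⁻¹) * u⁻¹⁻¹ = cs.simple i := by group
  have e2 : cs.simple i * cs.simple i * (cs.simple i)⁻¹ = cs.simple i := by group
  rw [e1, e2, signFlip_simple]
  simp only [if_true]
  linear_combination h1

theorem isRightInversion_of_signFlip {w t : W} (h : signFlip cs w t = 1) :
    cs.IsRightInversion w t := by
  classical
  obtain ⟨ω, hω, rfl⟩ := cs.exists_isReduced w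
  apply cs.isRightInversion_of_mem_rightInvSeq hω
  have h2 := signedRep_wordProd cs ω (t, 0)
  rw [signFlip, h2] at h
  by_contra hn
  rw [List.count_eq_zero_of_not_mem hn] at h
  simp at h

theorem signFlip_eq_one_iff {w t : W} (ht : cs.IsReflection t) :
    signFlip cs w t = 1 ↔ cs.length (w * t) < cs.length w := by
  refine ⟨fun h => (isRightInversion_of_signFlip cs h).2, fun h => ?_⟩
  by_contra hn
  have h0 : signFlip cs w t = 0 := by
    have : ∀ z : ZMod 2, z ≠ 1 → z = 0 := by decide
    exact this _ hn
  have h1 : signFlip cs (w * t) t = 1 := by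
    rw [signFlip_mul, signFlip_self cs ht, ht.inv, ht.mul_self, one_mul, h0, add_zero]
  have h2 := (isRightInversion_of_signFlip cs h1).2
  rw [mul_assoc, ht.mul_self, mul_one] at h2
  omega

end Exchange

/-! ### Bruhat steps -/

section Bruhat

variable {cs : CoxeterSystem M W}

theorem bruhatStep_iff {a b : W} :
    BruhatStep cs a b ↔ cs.IsReflection (a⁻¹ * b) ∧ cs.length a < cs.length b := by
  constructor
  · rintro ⟨t, ht, rfl, hl⟩
    refine ⟨?_, hl⟩
    have := ht.conj a⁻¹
    simpa [mul_assoc] using this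
  · rintro ⟨h, hl⟩
    refine ⟨b * a⁻¹, ?_, by group, hl⟩
    have := h.conj a
    simpa [mul_assoc] using this

/-- Right multiplication by a simple reflection preserves a Bruhat step or swaps its ends. -/
theorem BruhatStep.mul_simple {x y : W} (h : BruhatStep cs x y) (i : B) :
    x * cs.simple i = y ∨ BruhatStep cs (x * cs.simple i) (y * cs.simple i) := by
  obtain ⟨t, ht, rfl, hl⟩ := h
  by_cases hlt : cs.length (x * cs.simple i) < cs.length (t * x * cs.simple i)
  · exact Or.inr ⟨t, ht, by rw [mul_assoc], hlt⟩
  left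
  have hne := ht.length_mul_right_ne (x * cs.simple i)
  rw [← mul_assoc] at hne
  have hlen : ∀ z : W, cs.length (z⁻¹ * t) = cs.length (t * z) := fun z => by
    rw [← cs.length_inv, mul_inv_rev, ht.inv, inv_inv]
  have h1 : signFlip cs (x * cs.simple i)⁻¹ t = 1 := by
    rw [signFlip_eq_one_iff cs ht, hlen, cs.length_inv, ← mul_assoc]
    omega
  have h0 : signFlip cs x⁻¹ t ≠ 1 := by
    rw [Ne, signFlip_eq_one_iff cs ht, hlen, cs.length_inv]
    omega
  have hz : ∀ z : ZMod 2, z ≠ 1 → z = 0 := by decide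
  rw [mul_inv_rev, signFlip_mul, hz _ h0, zero_add, cs.inv_simple, signFlip_simple] at h1
  split_ifs at h1 with h2
  · rw [← h2]; group
  · simp at h1

theorem bruhatStep_mul_simple {x : W} {i : B} (h : cs.length (x * cs.simple i) < cs.length x) :
    BruhatStep cs (x * cs.simple i) x :=
  bruhatStep_iff.2 ⟨by simpa using cs.isReflection_simple i, h⟩

theorem BruhatLE.mul_simple_le {a x : W} (h : BruhatLE cs a x) {i : B}
    (hi : cs.length (x * cs.simple i) < cs.length x) : BruhatLE cs (a * cs.simple i) x := by
  induction h using Relation.ReflTransGen.head_induction_on with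
  | refl => exact Relation.ReflTransGen.single (bruhatStep_mul_simple hi)
  | head hstep hle ih =>
    rcases hstep.mul_simple i with h' | h'
    · rw [h']; exact hle
    · exact Relation.ReflTransGen.head h' ih

theorem one_bruhatLE (x : W) : BruhatLE cs 1 x := by
  generalize hn : cs.length x = n
  induction n generalizing x with
  | zero => rw [cs.length_eq_zero_iff.1 hn]; exact Relation.ReflTransGen.refl
  | succ n ih =>
    obtain ⟨i, hi⟩ := cs.exists_rightDescent_of_ne_one (w := x) (by
      rintro rfl; simp at hn)
    have h2 := cs.isRightDescent_iff.1 hi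
    exact Relation.ReflTransGen.tail (ih (x * cs.simple i) (by omega)) (bruhatStep_mul_simple hi)

end Bruhat

/-! ### Lower intervals are zircons -/

theorem isZircon_lower (cs : CoxeterSystem M W) [Finite W] (x : W) :
    IsZircon (BruhatInterval cs 1 x) := by
  intro z hz
  refine ⟨Set.toFinite _, ?_⟩
  have hz1 : z.1 ≠ 1 := by
    rintro h
    obtain ⟨y, hy⟩ := hz
    have h2 : BruhatLE cs y.1 z.1 := hy.le
    rw [h] at h2
    have h3 : y.1 = z.1 := by rw [h]; exact h2.antisymm (one_bruhatLE _)
    exact hy.ne (Subtype.ext h3)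
  obtain ⟨i, hi⟩ := cs.exists_rightDescent_of_ne_one hz1
  have hmem : ∀ v : W, BruhatLE cs v z.1 → BruhatLE cs (v * cs.simple i) z.1 :=
    fun v hv => hv.mul_simple_le hi
  let f : {v : BruhatInterval cs 1 x // v ≤ z} → {v : BruhatInterval cs 1 x // v ≤ z} :=
    fun v => ⟨⟨v.1.1 * cs.simple i, one_bruhatLE _, (hmem _ v.2).trans z.2.2⟩, hmem _ v.2⟩
  have hlt : ∀ {a b : {v : BruhatInterval cs 1 x // v ≤ z}}, BruhatStep cs a.1.1 b.1.1 →
      a < b := by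
    intro a b h
    refine lt_of_le_of_ne (Relation.ReflTransGen.single h) ?_
    rintro rfl
    exact (bruhatStep_iff.1 h).2.ne rfl
  have hlen : ∀ {a b : {v : BruhatInterval cs 1 x // v ≤ z}}, a < b →
      cs.length a.1.1 < cs.length b.1.1 := by
    intro a b h
    refine BruhatLE.length_lt h.le fun he => h.ne (Subtype.ext (Subtype.ext he))
  have hcov : ∀ {a b : {v : BruhatInterval cs 1 x // v ≤ z}}, BruhatStep cs a.1.1 b.1.1 →
      cs.length b.1.1 ≤ cs.length a.1.1 + 1 → a ⋖ b := by
    intro a b h h2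
    refine ⟨hlt h, fun c hac hcb => ?_⟩
    have := hlen hac
    have := hlen hcb
    omega
  refine ⟨f, ⟨fun v => ?_, fun v => ?_⟩, fun a b hab => ?_⟩
  · apply Subtype.ext; apply Subtype.ext
    simp [f]
  · rcases cs.length_mul_simple v.1.1 i with h | h
    · right
      refine hcov ?_ h.le
      refine bruhatStep_iff.2 ⟨by simpa [f] using cs.isReflection_simple i, ?_⟩
      change _ < cs.length (v.1.1 * cs.simple i)
      omega
    · left
      exact hcov (bruhatStep_mul_simple (by omega)) h.ge
  · have hab' : BruhatLE cs a.1.1 b.1.1 := hab.1.le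
    rcases Relation.ReflTransGen.cases_head hab' with h | ⟨c, hc, hcb⟩
    · exact absurd (Subtype.ext (Subtype.ext h)) hab.1.ne
    · have hcz : BruhatLE cs c z.1 := hcb.trans b.2
      let c' : {v : BruhatInterval cs 1 x // v ≤ z} :=
        ⟨⟨c, one_bruhatLE _, hcz.trans z.2.2⟩, hcz⟩
      have hcb' : c' = b := by
        by_contra hne
        exact hab.2 (hlt (a := a) (b := c') hc) (lt_of_le_of_ne hcb hne)
      have hstep : BruhatStep cs a.1.1 b.1.1 := by rw [← hcb']; exact hc
      rcases hstep.mul_simple i with h | h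
      · left; exact Subtype.ext (Subtype.ext h)
      · right; exact hlt h

/-! ### The geometric representation of a simply laced Coxeter group -/

/-- A Coxeter matrix whose off-diagonal entries are `2` or `3`. -/
class SimplyLaced {B : Type*} (M : CoxeterMatrix B) : Prop where
  mem : ∀ i j : B, i ≠ j → M i j ∈ ({2, 3} : Set ℕ)

section Geometric

open Classical in
/-- The Cartan integers of a simply laced Coxeter matrix. -/
noncomputable def cartan (M : CoxeterMatrix B) (i j : B) : ℤ :=
  if i = j then 2 else if M i j = 3 then -1 else 0

theorem cartan_symm (M : CoxeterMatrix B) (i j : B) : cartan M i j = cartan M j i := by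
  rcases eq_or_ne i j with rfl | h
  · rfl
  · simp [cartan, h, h.symm, M.symmetric i j]

/-- The symmetric bilinear form with the Cartan integers as Gram matrix. -/
noncomputable def cform (M : CoxeterMatrix B) : (B →₀ ℤ) →ₗ[ℤ] (B →₀ ℤ) →ₗ[ℤ] ℤ :=
  Finsupp.linearCombination ℤ fun i => Finsupp.linearCombination ℤ fun j => cartan M i j

theorem cform_single (M : CoxeterMatrix B) (i j : B) :
    cform M (Finsupp.single i 1) (Finsupp.single j 1) = cartan M i j := by
  simp [cform]

theorem cform_symm (M : CoxeterMatrix B) (v w : B →₀ ℤ) : cform M v w = cform M w v := by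
  have : cform M = (cform M).flip := by
    ext i j
    simp [cform_single, cartan_symm M i j]
  conv_lhs => rw [this]
  rfl

/-- The reflection in the vector `a`. -/
noncomputable def reflMap (M : CoxeterMatrix B) (a : B →₀ ℤ) : Module.End ℤ (B →₀ ℤ) :=
  LinearMap.id - (cform M a).smulRight a

theorem reflMap_apply (M : CoxeterMatrix B) (a v : B →₀ ℤ) :
    reflMap M a v = v - cform M a v • a := rfl

theorem reflMap_self {a : B →₀ ℤ} (ha : cform M a a = 2) : reflMap M a a = -a := by
  rw [reflMap_apply, ha]; module

theorem reflMap_reflMap {a : B →₀ ℤ} (ha : cform M a a = 2) (v : B →₀ ℤ) :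
    reflMap M a (reflMap M a v) = v := by
  simp only [reflMap_apply, map_sub, map_smul, ha]
  module

theorem cform_reflMap {a : B →₀ ℤ} (ha : cform M a a = 2) (v w : B →₀ ℤ) :
    cform M (reflMap M a v) (reflMap M a w) = cform M v w := by
  simp only [reflMap_apply, map_sub, map_smul, ha, smul_eq_mul, LinearMap.sub_apply,
    LinearMap.smul_apply, cform_symm M v a]
  ring

theorem reflMap_neg (a : B →₀ ℤ) : reflMap M (-a) = reflMap M a := by
  refine LinearMap.ext fun v => ?_
  simp [reflMap_apply]

theorem reflMap_mul_self {a : B →₀ ℤ} (ha : cform M a a = 2) :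
    reflMap M a * reflMap M a = 1 :=
  LinearMap.ext fun v => reflMap_reflMap ha v

theorem reflMap_commute {a b : B →₀ ℤ} (hab : cform M a b = 0) :
    reflMap M a * reflMap M b = reflMap M b * reflMap M a := by
  have hba : cform M b a = 0 := by rw [cform_symm, hab]
  refine LinearMap.ext fun v => ?_
  simp only [Module.End.mul_apply, reflMap_apply, map_sub, map_smul, hab, hba]
  module

theorem reflMap_braid {a b : B →₀ ℤ} (ha : cform M a a = 2) (hb : cform M b b = 2)
    (hab : cform M a b = 1 ∨ cform M a b = -1) :
    reflMap M a * reflMap M b * reflMap M a = reflMap M b * reflMap M a * reflMap M b := by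
  have hba := cform_symm M b a
  refine LinearMap.ext fun v => ?_
  rcases hab with hab | hab <;> rw [hab] at hba <;>
  · simp only [Module.End.mul_apply, reflMap_apply, map_sub, map_smul, ha, hb, hab, hba]
    module

theorem cform_simple_self (M : CoxeterMatrix B) (i : B) :
    cform M (Finsupp.single i 1) (Finsupp.single i 1) = 2 := by
  simp [cform_single, cartan]

theorem reflMap_isLiftable [SimplyLaced M] :
    M.IsLiftable fun i => reflMap M (Finsupp.single i 1) := by
  intro i j
  have hi := cform_simple_self M i
  have hj := cform_simple_self M j
  by_cases hij : i = j
  · subst hij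
    rw [M.diagonal, pow_one]
    exact reflMap_mul_self hi
  rcases SimplyLaced.mem (M := M) i j hij with h | h
  · have hab : cform M (Finsupp.single i 1) (Finsupp.single j 1) = 0 := by
      simp [cform_single, cartan, hij, h]
    rw [h, pow_two]
    beta_reduce
    calc _ = reflMap M (Finsupp.single i 1) * (reflMap M (Finsupp.single j 1) *
          reflMap M (Finsupp.single i 1)) * reflMap M (Finsupp.single j 1) := by
            simp only [mul_assoc]
      _ = 1 := by
        rw [← reflMap_commute hab, ← mul_assoc, reflMap_mul_self hi, one_mul,
          reflMap_mul_self hj]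
  · have h3 : M i j = 3 := h
    have hab : cform M (Finsupp.single i 1) (Finsupp.single j 1) = -1 := by
      simp [cform_single, cartan, hij, h3]
    rw [h3, pow_succ, pow_two]
    beta_reduce
    calc _ = reflMap M (Finsupp.single i 1) * reflMap M (Finsupp.single j 1) *
          reflMap M (Finsupp.single i 1) * (reflMap M (Finsupp.single j 1) *
          reflMap M (Finsupp.single i 1) * reflMap M (Finsupp.single j 1)) := by
            simp only [mul_assoc]
      _ = reflMap M (Finsupp.single i 1) * (reflMap M (Finsupp.single j 1) *
          (reflMap M (Finsupp.single i 1) * reflMap M (Finsupp.single i 1)) *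
          reflMap M (Finsupp.single j 1)) * reflMap M (Finsupp.single i 1) := by
            rw [← reflMap_braid hi hj (Or.inr hab)]; simp only [mul_assoc]
      _ = 1 := by
        rw [reflMap_mul_self hi, mul_one, reflMap_mul_self hj, mul_one, reflMap_mul_self hi]

variable [SimplyLaced M] (cs : CoxeterSystem M W)

/-- The geometric representation. -/
noncomputable def geomRep : W →* Module.End ℤ (B →₀ ℤ) :=
  cs.lift ⟨_, reflMap_isLiftable⟩

theorem geomRep_simple (i : B) :
    geomRep cs (cs.simple i) = reflMap M (Finsupp.single i 1) :=
  cs.lift_apply_simple reflMap_isLiftable i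

theorem geomRep_mul (x y : W) (v : B →₀ ℤ) :
    geomRep cs (x * y) v = geomRep cs x (geomRep cs y v) := by
  rw [map_mul]; rfl

theorem geomRep_apply_inv (x : W) (v : B →₀ ℤ) : geomRep cs x (geomRep cs x⁻¹ v) = v := by
  rw [← geomRep_mul, mul_inv_cancel, map_one]; rfl

theorem cform_geomRep (w : W) (u v : B →₀ ℤ) :
    cform M (geomRep cs w u) (geomRep cs w v) = cform M u v := by
  induction w using cs.simple_induction_left with
  | one => simp
  | mul_simple_left w i ih =>
    rw [geomRep_mul, geomRep_mul, geomRep_simple, cform_reflMap (cform_simple_self M i), ih]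

theorem geomRep_simple_self (i : B) :
    geomRep cs (cs.simple i) (Finsupp.single i 1) = -Finsupp.single i 1 := by
  rw [geomRep_simple, reflMap_self (cform_simple_self M i)]

/-- Lengthening on the right by a simple reflection means sending its root to a nonnegative
vector. -/
theorem geomRep_single_nonneg (w : W) (i : B)
    (h : cs.length w < cs.length (w * cs.simple i)) :
    0 ≤ geomRep cs w (Finsupp.single i 1) := by
  generalize hn : cs.length w = n
  induction n using Nat.strong_induction_on generalizing w i with
  | _ n ih =>
    subst hn
    by_cases hw : w = 1
    · subst hw
      rw [map_one]
      exact Finsupp.single_nonneg.2 zero_le_one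
    obtain ⟨j, hj⟩ := cs.exists_rightDescent_of_ne_one hw
    unfold CoxeterSystem.IsRightDescent at hj
    have hij : i ≠ j := by rintro rfl; omega
    obtain ⟨v, rfl⟩ : ∃ v, w = v * cs.simple j := ⟨w * cs.simple j, by simp⟩
    simp only [CoxeterSystem.simple_mul_simple_cancel_right] at hj
    have hjpos := ih _ hj v j hj rfl
    rw [geomRep_mul, geomRep_simple, reflMap_apply, cform_single]
    rcases SimplyLaced.mem (M := M) j i hij.symm with hm | hm
    · have hm' : M j i = 2 := hm
      have hcomm : cs.simple j * cs.simple i = cs.simple i * cs.simple j := by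
        have := cs.simple_mul_simple_pow j i
        rw [hm', pow_two] at this
        have h3 := eq_inv_of_mul_eq_one_left this
        simpa using h3
      have hvi : cs.length v < cs.length (v * cs.simple i) := by
        by_contra hlt
        have h1 := cs.length_mul_simple v i
        have h2 := cs.length_mul_simple (v * cs.simple i) j
        rw [mul_assoc, ← hcomm, ← mul_assoc] at h2
        omega
      have := ih _ hj v i hvi rfl
      simpa [cartan, hij.symm, hm'] using this
    · have hm' : M j i = 3 := hm
      have hbraid : cs.simple j * cs.simple i * cs.simple j =
          cs.simple i * cs.simple j * cs.simple i := by
        have := cs.simple_mul_simple_pow j i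
        rw [hm', pow_succ, pow_two] at this
        have h3 := eq_inv_of_mul_eq_one_left
          (show cs.simple j * cs.simple i * cs.simple j *
            (cs.simple i * cs.simple j * cs.simple i) = 1 by simpa [mul_assoc] using this)
        simpa [mul_assoc] using h3
      have hgoal : geomRep cs v (Finsupp.single i 1 - cartan M j i • Finsupp.single j 1) =
          geomRep cs v (Finsupp.single i 1) + geomRep cs v (Finsupp.single j 1) := by
        simp [cartan, hij.symm, hm']
      rw [hgoal]
      by_cases hvi : cs.length v < cs.length (v * cs.simple i)
      · exact add_nonneg (ih _ hj v i hvi rfl) hjpos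
      have hvi' := cs.length_mul_simple v i
      obtain ⟨u, rfl⟩ : ∃ u, v = u * cs.simple i := ⟨v * cs.simple i, by simp⟩
      simp only [CoxeterSystem.simple_mul_simple_cancel_right] at hvi hvi'
      have huj : cs.length u < cs.length (u * cs.simple j) := by
        by_contra hlt
        have h1 := cs.length_mul_simple u j
        have h2 := cs.length_mul_simple (u * cs.simple j) i
        have h3 := cs.length_mul_simple (u * cs.simple j * cs.simple i) j
        have e1 : u * cs.simple j * cs.simple i * cs.simple j =
            u * cs.simple i * cs.simple j * cs.simple i := by
          simpa [mul_assoc] using congrArg (u * ·) hbraid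
        rw [e1] at h3
        omega
      have hu := ih (cs.length u) (by omega) u j huj rfl
      have : geomRep cs (u * cs.simple i) (Finsupp.single i 1) +
          geomRep cs (u * cs.simple i) (Finsupp.single j 1) =
          geomRep cs u (Finsupp.single j 1) := by
        rw [← map_add, geomRep_mul, map_add, geomRep_simple_self, geomRep_simple, reflMap_apply,
          cform_single, cartan_symm M i j]
        simp [cartan, hij.symm, hm']
      rw [this]
      exact hu

theorem geomRep_single_nonpos (w : W) (i : B)
    (h : cs.length (w * cs.simple i) < cs.length w) :
    geomRep cs w (Finsupp.single i 1) ≤ 0 := by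
  have := geomRep_single_nonneg cs (w * cs.simple i) i (by simpa using h)
  rw [geomRep_mul, geomRep_simple_self, map_neg] at this
  exact neg_nonneg.1 this

/-- The geometric representation is faithful. -/
theorem geomRep_injective : Function.Injective (geomRep cs) := by
  rw [injective_iff_map_eq_one]
  intro w hw
  by_contra hne
  obtain ⟨i, hi⟩ := cs.exists_rightDescent_of_ne_one hne
  have h := geomRep_single_nonpos cs w i hi
  rw [hw] at h
  have := h i
  simp at this

/-! ### Roots -/

/-- The roots are the translates of the simple roots. -/
def IsRoot (v : B →₀ ℤ) : Prop := ∃ (w : W) (i : B), v = geomRep cs w (Finsupp.single i 1)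

variable {cs}

theorem isRoot_single (i : B) : IsRoot cs (Finsupp.single i 1) := ⟨1, i, by simp⟩

theorem IsRoot.map {v : B →₀ ℤ} (h : IsRoot cs v) (w : W) :
    IsRoot cs (geomRep cs w v) := by
  obtain ⟨u, i, rfl⟩ := h
  exact ⟨w * u, i, by rw [geomRep_mul]⟩

theorem IsRoot.neg {v : B →₀ ℤ} (h : IsRoot cs v) : IsRoot cs (-v) := by
  obtain ⟨u, i, rfl⟩ := h
  exact ⟨u * cs.simple i, i, by rw [geomRep_mul, geomRep_simple_self, map_neg]⟩

theorem IsRoot.cform_self {v : B →₀ ℤ} (h : IsRoot cs v) : cform M v v = 2 := by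
  obtain ⟨u, i, rfl⟩ := h
  rw [cform_geomRep, cform_simple_self]

theorem IsRoot.nonneg_or_nonpos {v : B →₀ ℤ} (h : IsRoot cs v) : 0 ≤ v ∨ v ≤ 0 := by
  obtain ⟨u, i, rfl⟩ := h
  rcases lt_or_gt_of_ne (cs.length_mul_simple_ne u i) with h | h
  · exact Or.inr (geomRep_single_nonpos cs u i h)
  · exact Or.inl (geomRep_single_nonneg cs u i h)

theorem IsRoot.ne_zero {v : B →₀ ℤ} (h : IsRoot cs v) : v ≠ 0 := by
  rintro rfl
  simpa using h.cform_self

theorem IsRoot.nonpos_of_not_nonneg {v : B →₀ ℤ} (h : IsRoot cs v) (hn : ¬ 0 ≤ v) : v ≤ 0 :=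
  h.nonneg_or_nonpos.resolve_left hn

theorem IsRoot.not_nonpos {v : B →₀ ℤ} (h : IsRoot cs v) (hn : 0 ≤ v) : ¬ v ≤ 0 :=
  fun h' => h.ne_zero (le_antisymm h' hn)

theorem reflMap_geomRep (w : W) (v : B →₀ ℤ) :
    reflMap M (geomRep cs w v) = geomRep cs w * reflMap M v * geomRep cs w⁻¹ := by
  apply LinearMap.ext
  intro x
  simp only [Module.End.mul_apply, reflMap_apply, map_sub, map_smul, geomRep_apply_inv]
  congr 2
  conv_lhs => rw [← geomRep_apply_inv cs w x]
  rw [cform_geomRep]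

/-- `v` is a positive root, and `t` acts as the reflection in `v`. -/
structure IsPosRootOf (cs : CoxeterSystem M W) (v : B →₀ ℤ) (t : W) : Prop where
  nonneg : 0 ≤ v
  isRoot : IsRoot cs v
  geomRep_eq : geomRep cs t = reflMap M v

theorem IsRoot.exists_reflection {v : B →₀ ℤ} (h : IsRoot cs v) :
    ∃ t, cs.IsReflection t ∧ geomRep cs t = reflMap M v := by
  obtain ⟨u, i, rfl⟩ := h
  refine ⟨u * cs.simple i * u⁻¹, ⟨u, i, rfl⟩, ?_⟩
  rw [reflMap_geomRep, map_mul, map_mul, geomRep_simple]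

theorem IsPosRootOf.isReflection {v : B →₀ ℤ} {t : W} (h : IsPosRootOf cs v t) :
    cs.IsReflection t := by
  obtain ⟨t', ht', h'⟩ := h.isRoot.exists_reflection
  rwa [geomRep_injective cs (h.geomRep_eq.trans h'.symm)]

theorem exists_isPosRootOf {t : W} (ht : cs.IsReflection t) : ∃ v, IsPosRootOf cs v t := by
  obtain ⟨u, i, rfl⟩ := ht
  have hr : IsRoot cs (geomRep cs u (Finsupp.single i 1)) := ⟨u, i, rfl⟩
  have he : geomRep cs (u * cs.simple i * u⁻¹) = reflMap M (geomRep cs u (Finsupp.single i 1)) := by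
    rw [reflMap_geomRep, map_mul, map_mul, geomRep_simple]
  rcases hr.nonneg_or_nonpos with h | h
  · exact ⟨_, h, hr, he⟩
  · exact ⟨_, neg_nonneg.2 h, hr.neg, by rw [he, reflMap_neg]⟩

/-- A positive root other than the simple root `αᵢ` stays positive under `sᵢ`. -/
theorem IsRoot.simple_nonneg {v : B →₀ ℤ} (h : IsRoot cs v) (h0 : 0 ≤ v) {i : B}
    (hne : v ≠ Finsupp.single i 1) : 0 ≤ geomRep cs (cs.simple i) v := by
  have hr := h.map (cs.simple i)
  by_contra hn
  have hneg := hr.nonpos_of_not_nonneg hn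
  rw [geomRep_simple, reflMap_apply] at hneg
  have hsupp : ∀ j, j ≠ i → v j = 0 := fun j hj => by
    have h1 := hneg j
    have h2 := h0 j
    simp [hj.symm] at h1 h2
    omega
  have hv : v = v i • Finsupp.single i 1 := by
    ext j
    by_cases hj : j = i
    · subst hj; simp
    · simp [hsupp j hj, Ne.symm hj]
  have h2 := h.cform_self
  have hvi := h0 i
  simp only [Finsupp.coe_zero, Pi.zero_apply] at hvi
  generalize v i = k at *
  subst hv
  simp only [map_smul, LinearMap.smul_apply, cform_simple_self, smul_eq_mul] at h2
  have hk : k = 1 := by nlinarith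
  exact hne (by simp [hk])

theorem isPosRootOf_single (i : B) : IsPosRootOf cs (Finsupp.single i 1) (cs.simple i) :=
  ⟨Finsupp.single_nonneg.2 zero_le_one, isRoot_single i, geomRep_simple cs i⟩

theorem geomRep_conj_eq {t w : W} {v : B →₀ ℤ} (h : geomRep cs t = reflMap M v) :
    geomRep cs (w * t * w⁻¹) = reflMap M (geomRep cs w v) := by
  rw [reflMap_geomRep, map_mul, map_mul, h]

theorem IsPosRootOf.length_lt_of_nonpos {v : B →₀ ℤ} {t : W} (h : IsPosRootOf cs v t) {w : W}
    (hw : geomRep cs w v ≤ 0) : cs.length (w * t) < cs.length w := by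
  generalize hn : cs.length w = n
  induction n using Nat.strong_induction_on generalizing w v t with
  | _ n ih =>
    subst hn
    have hw1 : w ≠ 1 := by
      rintro rfl
      rw [map_one] at hw
      exact h.isRoot.not_nonpos h.nonneg hw
    obtain ⟨i, hi⟩ := cs.exists_rightDescent_of_ne_one hw1
    unfold CoxeterSystem.IsRightDescent at hi
    by_cases hv : v = Finsupp.single i 1
    · subst hv
      rw [geomRep_injective cs (h.geomRep_eq.trans (geomRep_simple cs i).symm)]
      exact hi
    · have h' : IsPosRootOf cs (geomRep cs (cs.simple i) v)
          (cs.simple i * t * (cs.simple i)⁻¹) :=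
        ⟨h.isRoot.simple_nonneg h.nonneg hv, h.isRoot.map _, geomRep_conj_eq h.geomRep_eq⟩
      have h2 := ih _ hi h' (w := w * cs.simple i) (by
        rw [← geomRep_mul]; simpa using hw) rfl
      have e : w * cs.simple i * (cs.simple i * t * (cs.simple i)⁻¹) = w * t * cs.simple i := by
        simp [mul_assoc]
      rw [e] at h2
      have := cs.length_mul_simple (w * t) i
      have := cs.length_mul_simple w i
      omega

theorem IsPosRootOf.geomRep_self {v : B →₀ ℤ} {t : W} (h : IsPosRootOf cs v t) :
    geomRep cs t v = -v := by
  rw [h.geomRep_eq, reflMap_self h.isRoot.cform_self]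

theorem IsPosRootOf.length_lt_of_nonneg {v : B →₀ ℤ} {t : W} (h : IsPosRootOf cs v t) {w : W}
    (hw : 0 ≤ geomRep cs w v) : cs.length w < cs.length (w * t) := by
  have := h.length_lt_of_nonpos (w := w * t) (by
    rw [geomRep_mul, h.geomRep_self, map_neg]
    exact neg_nonpos.2 hw)
  rwa [mul_assoc, h.isReflection.mul_self, mul_one] at this

theorem IsPosRootOf.length_lt_iff {v : B →₀ ℤ} {t : W} (h : IsPosRootOf cs v t) {w : W} :
    cs.length w < cs.length (w * t) ↔ 0 ≤ geomRep cs w v := by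
  refine ⟨fun hl => ?_, h.length_lt_of_nonneg⟩
  by_contra hn
  have := h.length_lt_of_nonpos ((h.isRoot.map w).nonpos_of_not_nonneg hn)
  omega

end Geometric

/-! ### Products of two reflections -/

section Pairs

variable [SimplyLaced M] {cs : CoxeterSystem M W}

theorem IsPosRootOf.eq_of_eq_or_eq_neg {a b : B →₀ ℤ} {t u : W} (ha : IsPosRootOf cs a t)
    (hb : IsPosRootOf cs b u) (h : a = b ∨ a = -b) : t = u := by
  apply geomRep_injective cs
  rw [ha.geomRep_eq, hb.geomRep_eq]
  rcases h with rfl | rfl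
  · rfl
  · rw [reflMap_neg]

theorem IsPosRootOf.commute {a b : B →₀ ℤ} {t u : W} (ha : IsPosRootOf cs a t)
    (hb : IsPosRootOf cs b u) (h : cform M a b = 0) : t * u = u * t := by
  apply geomRep_injective cs
  rw [map_mul, map_mul, ha.geomRep_eq, hb.geomRep_eq, reflMap_commute h]

theorem IsPosRootOf.braid {a b : B →₀ ℤ} {t u : W} (ha : IsPosRootOf cs a t)
    (hb : IsPosRootOf cs b u) (h : cform M a b = 1 ∨ cform M a b = -1) :
    t * u * t = u * t * u := by
  apply geomRep_injective cs
  simp only [map_mul, ha.geomRep_eq, hb.geomRep_eq]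
  exact reflMap_braid ha.isRoot.cform_self hb.isRoot.cform_self h

theorem IsPosRootOf.conj_eq {a b : B →₀ ℤ} {t u : W} (ha : IsPosRootOf cs a t)
    (hb : IsPosRootOf cs b u) :
    geomRep cs (t * u * t) = reflMap M (b - cform M a b • a) := by
  have := geomRep_conj_eq (w := t) hb.geomRep_eq
  rw [ha.isReflection.inv] at this
  rw [this, ha.geomRep_eq, reflMap_apply]

theorem IsRoot.exists_isPosRootOf {v : B →₀ ℤ} (h : IsRoot cs v) (h0 : 0 ≤ v) :
    ∃ t, IsPosRootOf cs v t :=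
  let ⟨t, _, ht⟩ := h.exists_reflection
  ⟨t, h0, h, ht⟩

theorem IsPosRootOf.bruhatStep {x t : W} {v : B →₀ ℤ} (h : IsPosRootOf cs v t)
    (hx : 0 ≤ geomRep cs x v) : BruhatStep cs x (x * t) :=
  bruhatStep_iff.2 ⟨by simpa using h.isReflection, h.length_lt_of_nonneg hx⟩

end Pairs

section FiniteType

variable [SimplyLaced M] [Finite W] {cs : CoxeterSystem M W}

theorem IsRoot.cform_lt_two {a b : B →₀ ℤ} (ha : IsRoot cs a) (hb : IsRoot cs b) (hne : a ≠ b) :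
    cform M a b < 2 := by
  by_contra hc
  push Not at hc
  obtain ⟨t, -, ht⟩ := ha.exists_reflection
  obtain ⟨u, -, hu⟩ := hb.exists_reflection
  have haa := ha.cform_self
  have hbb := hb.cform_self
  have hba := cform_symm M b a
  generalize hcc : cform M a b = c at *
  have key : ∀ n : ℕ, ∃ p d : ℤ, geomRep cs ((t * u) ^ n) a = p • a - d • b ∧ d < p ∧ 0 ≤ d ∧
      (0 < n → 0 < d) := by
    intro n
    induction n with
    | zero => exact ⟨1, 0, by simp, by simp, by simp, by simp⟩
    | succ n ih =>
      obtain ⟨p, d, he, hdp, hd, -⟩ := ih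
      have h1 : p < c * p - d := by nlinarith
      refine ⟨(c ^ 2 - 1) * p - c * d, c * p - d, ?_, by nlinarith, by linarith,
        fun _ => by linarith⟩
      rw [pow_succ', geomRep_mul, he, geomRep_mul, ht, hu]
      simp only [reflMap_apply, map_sub, map_smul, haa, hbb, hba, hcc]
      module
  obtain ⟨p, d, he, hdp, -, hd⟩ := key (orderOf (t * u))
  have hd := hd (orderOf_pos _)
  rw [pow_orderOf_eq_one, map_one, Module.End.one_apply] at he
  have h1 := congrArg (cform M a) he
  have h2 := congrArg (cform M b) he
  simp only [map_sub, map_smul, haa, hbb, hba, hcc, smul_eq_mul] at h1 h2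
  have h3 : d * (c ^ 2 - 4) = 0 := by linear_combination c * h1 - 2 * h2
  have h4 : c = 2 := by
    rcases mul_eq_zero.1 h3 with h | h
    · omega
    · nlinarith
  subst h4
  have h5 : p - 1 = d := by linarith
  have h6 : d • a = d • b := by
    rw [← h5] at he ⊢
    linear_combination (norm := module) (-1 : ℤ) • he
  exact hne (smul_right_injective _ hd.ne' h6)

theorem IsPosRootOf.cform_cases {a b : B →₀ ℤ} {t u : W} (ha : IsPosRootOf cs a t)
    (hb : IsPosRootOf cs b u) (hne : t ≠ u) :
    cform M a b = 0 ∨ cform M a b = 1 ∨ cform M a b = -1 := by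
  have h1 := ha.isRoot.cform_lt_two hb.isRoot fun h =>
    hne (ha.eq_of_eq_or_eq_neg hb (Or.inl h))
  have h2 := ha.isRoot.cform_lt_two hb.isRoot.neg fun h =>
    hne (ha.eq_of_eq_or_eq_neg hb (Or.inr h))
  rw [map_neg] at h2
  omega

/-- If `t₁`, `t₂` are distinct and `t₃t₁ = t₄t₂`, then all four reflections lie in the dihedral
group generated by `t₁` and `t₂`. -/
theorem reflection_plane {t₁ t₂ t₃ t₄ : W} (ht₁ : cs.IsReflection t₁) (ht₂ : cs.IsReflection t₂)
    (ht₃ : cs.IsReflection t₃) (ht₄ : cs.IsReflection t₄) (h : t₃ * t₁ = t₄ * t₂)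
    (h12 : t₁ ≠ t₂) (h13 : t₁ ≠ t₃) :
    t₃ = t₂ ∨ (t₁ * t₂ * t₁ = t₂ * t₁ * t₂ ∧ t₃ = t₁ * t₂ * t₁) := by
  obtain ⟨a₁, ha₁⟩ := exists_isPosRootOf ht₁
  obtain ⟨a₂, ha₂⟩ := exists_isPosRootOf ht₂
  obtain ⟨a₃, ha₃⟩ := exists_isPosRootOf ht₃
  obtain ⟨a₄, ha₄⟩ := exists_isPosRootOf ht₄
  have h24 : t₂ ≠ t₄ := by
    rintro rfl
    rw [ht₂.mul_self] at h
    exact h13 (by rw [← inv_eq_of_mul_eq_one_right h, ht₃.inv])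
  have hc12 := ha₁.cform_cases ha₂ h12
  have hc13 := ha₁.cform_cases ha₃ h13
  have hc24 := ha₂.cform_cases ha₄ h24
  have e3 : t₃ = t₄ * t₂ * t₁ := by rw [← h, mul_assoc, ht₁.mul_self, mul_one]
  by_cases h14 : t₁ = t₄
  · subst h14
    rcases hc12 with h0 | h1
    · left
      rw [e3, ha₁.commute ha₂ h0, mul_assoc, ht₁.mul_self, mul_one]
    · exact Or.inr ⟨ha₁.braid ha₂ h1, e3⟩
  have hc14 := ha₁.cform_cases ha₄ h14
  have n1 := ha₁.isRoot.cform_self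
  have n2 := ha₂.isRoot.cform_self
  have n3 := ha₃.isRoot.cform_self
  have n4 := ha₄.isRoot.cform_self
  have s31 := cform_symm M a₃ a₁
  have s21 := cform_symm M a₂ a₁
  have s41 := cform_symm M a₄ a₁
  have s42 := cform_symm M a₄ a₂
  have hv : ∀ v, reflMap M a₃ (reflMap M a₁ v) = reflMap M a₄ (reflMap M a₂ v) := fun v => by
    rw [← ha₁.geomRep_eq, ← ha₂.geomRep_eq, ← ha₃.geomRep_eq, ← ha₄.geomRep_eq, ← geomRep_mul,
      ← geomRep_mul, h]
  obtain ⟨k, P, Q, hk, hPQ⟩ : ∃ k P Q : ℤ, (k = 2 ∨ k = 3) ∧ k • a₁ = P • a₂ + Q • a₄ := by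
    have hv1 := hv a₁
    have hv3 := hv a₃
    simp only [reflMap_apply, map_sub, map_smul, n1, n3, s31] at hv1 hv3
    rcases hc13 with h0 | h1 | h1
    · refine ⟨2, cform M a₂ a₁, cform M a₄ a₁ - cform M a₂ a₁ * cform M a₄ a₂, Or.inl rfl, ?_⟩
      rw [h0] at hv1
      linear_combination (norm := module) (-1 : ℤ) • hv1
    · refine ⟨3, cform M a₂ a₁ + cform M a₂ a₃,
        cform M a₄ a₁ - cform M a₂ a₁ * cform M a₄ a₂ +
          (cform M a₄ a₃ - cform M a₂ a₃ * cform M a₄ a₂), Or.inr rfl, ?_⟩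
      rw [h1] at hv1 hv3
      linear_combination (norm := module) (-1 : ℤ) • hv1 - (1 : ℤ) • hv3
    · refine ⟨3, cform M a₂ a₁ - cform M a₂ a₃,
        cform M a₄ a₁ - cform M a₂ a₁ * cform M a₄ a₂ -
          (cform M a₄ a₃ - cform M a₂ a₃ * cform M a₄ a₂), Or.inr rfl, ?_⟩
      rw [h1] at hv1 hv3
      linear_combination (norm := module) (-1 : ℤ) • hv1 + (1 : ℤ) • hv3
  have q1 := congrArg (cform M a₁) hPQ
  have q2 := congrArg (cform M a₂) hPQ
  have q4 := congrArg (cform M a₄) hPQ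
  simp only [map_add, map_smul, smul_eq_mul, n1, n2, n4, s21, s41, s42] at q1 q2 q4
  have hfin : (cform M a₂ a₄ = 1 ∨ cform M a₂ a₄ = -1) ∧ k ≠ 0 ∧
      ((P = k ∧ Q = -k * cform M a₂ a₄) ∨ (P = -k ∧ Q = k * cform M a₂ a₄)) := by
    rcases hc12 with h1 | h1 | h1 <;> rcases hc14 with h2 | h2 | h2 <;>
      rcases hc24 with h3 | h3 | h3 <;> rw [h1] at q1 q2 <;> rw [h2] at q1 q4 <;>
      rw [h3] at q2 q4 ⊢ <;> omega
  obtain ⟨hb, hk0, hpq⟩ := hfin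
  have hbr := ha₂.braid ha₄ hb
  have e1 : a₁ = a₂ - cform M a₂ a₄ • a₄ ∨ a₁ = -(a₂ - cform M a₂ a₄ • a₄) := by
    rcases hpq with ⟨rfl, rfl⟩ | ⟨rfl, rfl⟩
    · left
      apply smul_right_injective _ hk0
      change _ • _ = _ • _
      rw [hPQ]; module
    · right
      apply smul_right_injective _ hk0
      change _ • _ = _ • _
      rw [hPQ]; module
  have e2 : t₁ = t₄ * t₂ * t₄ := by
    apply geomRep_injective cs
    rw [ha₄.conj_eq ha₂, ha₁.geomRep_eq, s42]
    rcases e1 with e | e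
    · rw [e]
    · rw [e, reflMap_neg]
  left
  rw [e3, e2, ← hbr]
  calc t₄ * t₂ * (t₂ * t₄ * t₂) = t₄ * (t₂ * t₂) * t₄ * t₂ := by simp only [mul_assoc]
    _ = t₂ := by rw [ht₂.mul_self, mul_one, ht₄.mul_self, one_mul]

/-- A point joined by reflections to the top of a pair of crossing squares is joined to the
bottom. -/
theorem isReflection_of_hexagon {b a₁ a₂ c₁ c₂ y : W}
    (hba₁ : cs.IsReflection (b⁻¹ * a₁)) (hba₂ : cs.IsReflection (b⁻¹ * a₂))
    (h11 : cs.IsReflection (a₁⁻¹ * c₁)) (h12 : cs.IsReflection (a₁⁻¹ * c₂))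
    (h21 : cs.IsReflection (a₂⁻¹ * c₁)) (h22 : cs.IsReflection (a₂⁻¹ * c₂))
    (hy₁ : cs.IsReflection (c₁⁻¹ * y)) (hy₂ : cs.IsReflection (c₂⁻¹ * y))
    (ha : a₁ ≠ a₂) (hc : c₁ ≠ c₂) (hbc₁ : b ≠ c₁) (hbc₂ : b ≠ c₂) (hya : y ≠ a₁) :
    cs.IsReflection (b⁻¹ * y) := by
  set t₁ := b⁻¹ * a₁ with et₁
  set t₂ := b⁻¹ * a₂ with et₂
  set p := a₁⁻¹ * c₁ with ep
  set q := a₁⁻¹ * c₂ with eq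
  set p' := a₂⁻¹ * c₁ with ep'
  set q' := a₂⁻¹ * c₂ with eq'
  set u := c₁⁻¹ * y with eu
  set u' := c₂⁻¹ * y with eu'
  have swap : ∀ {x z x' z' : W}, cs.IsReflection x → cs.IsReflection z → cs.IsReflection x' →
      cs.IsReflection z' → x * z = x' * z' → z * x = z' * x' := by
    intro x z x' z' hx hz hx' hz' h
    have := congrArg (·⁻¹) h
    simpa [hx.inv, hz.inv, hx'.inv, hz'.inv] using this
  have ht12 : t₁ ≠ t₂ := fun h => ha (by simpa [et₁, et₂] using h)
  have htp : t₁ ≠ p := fun h => hbc₁ (by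
    have h2 : t₁ * p = b⁻¹ * c₁ := by rw [et₁, ep]; group
    rw [← h, hba₁.mul_self] at h2
    exact (inv_mul_eq_one.1 h2.symm))
  have htq : t₁ ≠ q := fun h => hbc₂ (by
    have h2 : t₁ * q = b⁻¹ * c₂ := by rw [et₁, eq]; group
    rw [← h, hba₁.mul_self] at h2
    exact (inv_mul_eq_one.1 h2.symm))
  have hpq : p ≠ q := fun h => hc (by simpa [ep, eq] using h)
  have hpu : p ≠ u := fun h => hya (by
    have h2 : p * u = a₁⁻¹ * y := by rw [ep, eu]; group
    rw [← h, h11.mul_self] at h2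
    exact (inv_mul_eq_one.1 h2.symm).symm)
  have e1 : t₁ * p = t₂ * p' := by rw [et₁, et₂, ep, ep']; group
  have e2 : t₁ * q = t₂ * q' := by rw [et₁, et₂, eq, eq']; group
  have e3 : p * u = q * u' := by rw [ep, eq, eu, eu']; group
  have r1 := reflection_plane hba₁ hba₂ h11 h21 (swap hba₁ h11 hba₂ h21 e1) ht12 htp
  have r2 := reflection_plane hba₁ hba₂ h12 h22 (swap hba₁ h12 hba₂ h22 e2) ht12 htq
  have r3 := reflection_plane h11 h12 hy₁ hy₂ (swap h11 hy₁ h12 hy₂ e3) hpq hpu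
  have goal : b⁻¹ * y = t₁ * p * u := by rw [et₁, ep, eu]; group
  have c1 : ∀ z, t₁ * (t₁ * z) = z := fun z => by rw [← mul_assoc, hba₁.mul_self, one_mul]
  have c2 : ∀ z, t₂ * (t₂ * z) = z := fun z => by rw [← mul_assoc, hba₂.mul_self, one_mul]
  have conj12 : cs.IsReflection (t₁ * t₂ * t₁) := by
    have := hba₂.conj t₁
    rwa [hba₁.inv] at this
  rw [goal]
  clear_value t₁ t₂ p q p' q' u u'
  rcases r1 with rfl | ⟨hb, rfl⟩
  · rcases r2 with rfl | ⟨hb, rfl⟩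
    · exact absurd rfl hpq
    · rcases r3 with rfl | ⟨-, rfl⟩
      · have : t₁ * p * (t₁ * p * t₁) = p := by
          rw [hb]; simp only [mul_assoc, c1, c2]
        rwa [this]
      · have : t₁ * p * (p * (t₁ * p * t₁) * p) = p * t₁ * p := by
          simp only [mul_assoc, c2, c1]
        rw [this, ← hb]
        exact conj12
  · rcases r2 with rfl | ⟨-, rfl⟩
    · rcases r3 with rfl | ⟨-, rfl⟩
      · have : t₁ * (t₁ * u * t₁) * u = u * t₁ * u := by
          simp only [mul_assoc, c1]
        rw [this, ← hb]
        exact conj12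
      · have : t₁ * (t₁ * q * t₁) * (t₁ * q * t₁ * q * (t₁ * q * t₁)) = q := by
          rw [show t₁ * (t₁ * q * t₁) * (t₁ * q * t₁ * q * (t₁ * q * t₁)) =
            t₁ * q * t₁ * (q * t₁) by simp only [mul_assoc, c1, c2], hb]
          simp only [mul_assoc, c2, hba₁.mul_self, mul_one]
        rwa [this]
    · exact absurd rfl hpq

end FiniteType

/-! ### Long edges of the Bruhat graph -/

section LongEdges

variable [SimplyLaced M] [Finite W] {cs : CoxeterSystem M W}

/-- If `x → x * r` is an edge of the Bruhat graph that is not a cover, then the root of `r` splits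
as a sum of two positive roots which `x` keeps positive. -/
theorem IsPosRootOf.exists_add {x r : W} {v : B →₀ ℤ} (h : IsPosRootOf cs v r)
    (hlt : cs.length x < cs.length (x * r)) (hne : cs.length (x * r) ≠ cs.length x + 1) :
    ∃ a b, IsRoot cs a ∧ IsRoot cs b ∧ 0 ≤ a ∧ 0 ≤ b ∧ v = a + b ∧
      0 ≤ geomRep cs x a ∧ 0 ≤ geomRep cs x b := by
  generalize hn : cs.length x = n
  induction n using Nat.strong_induction_on generalizing x v r with
  | _ n ih =>
    subst hn
    have hy1 : x * r ≠ 1 := by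
      intro h0
      rw [h0, cs.length_one] at hlt
      omega
    obtain ⟨i, hi⟩ := cs.exists_rightDescent_of_ne_one hy1
    unfold CoxeterSystem.IsRightDescent at hi
    have hv : v ≠ Finsupp.single i 1 := by
      rintro rfl
      have hr : r = cs.simple i :=
        geomRep_injective cs (h.geomRep_eq.trans (geomRep_simple cs i).symm)
      subst hr
      have := cs.length_mul_simple x i
      omega
    have hyi := geomRep_single_nonpos cs _ i hi
    have hrs : r ≠ cs.simple i := by
      rintro rfl
      have := cs.length_mul_simple x i
      omega
    have hxv := h.length_lt_iff.1 hlt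
    rcases lt_or_gt_of_ne (cs.length_mul_simple_ne x i) with hx | hx
    · have h' : IsPosRootOf cs (geomRep cs (cs.simple i) v)
          (cs.simple i * r * (cs.simple i)⁻¹) :=
        ⟨h.isRoot.simple_nonneg h.nonneg hv, h.isRoot.map _, geomRep_conj_eq h.geomRep_eq⟩
      have e : x * cs.simple i * (cs.simple i * r * (cs.simple i)⁻¹) = x * r * cs.simple i := by
        simp [mul_assoc]
      have l1 := cs.length_mul_simple x i
      have l2 := cs.length_mul_simple (x * r) i
      obtain ⟨a, b, ha, hb, ha0, hb0, hab, hxa, hxb⟩ := ih _ hx h' (by rw [e]; omega)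
        (by rw [e]; omega) rfl
      have key : ∀ a b, IsRoot cs a → IsRoot cs b → geomRep cs (cs.simple i) v = a + b →
          0 ≤ geomRep cs (x * cs.simple i) b → a ≠ Finsupp.single i 1 := by
        rintro a b ha hb hab hxb rfl
        have n0 := (h.isRoot.map (cs.simple i)).cform_self
        have n1 := ha.cform_self
        have n2 := hb.cform_self
        have hs := cform_symm M b (Finsupp.single i 1)
        rw [hab] at n0
        simp only [map_add, LinearMap.add_apply, n1, n2, hs] at n0
        have h1 : geomRep cs (x * r * cs.simple i) (Finsupp.single i 1) =
            -geomRep cs (x * cs.simple i) b := by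
          rw [← e, geomRep_mul, h'.geomRep_eq, hab, reflMap_apply, ← map_neg]
          congr 1
          simp only [map_add, LinearMap.add_apply, n1, hs]
          rw [show cform M (Finsupp.single i 1) b = -1 by omega]
          module
        have h2 := geomRep_single_nonneg cs (x * r * cs.simple i) i (by simpa using hi)
        rw [h1] at h2
        exact (hb.map _).not_nonpos hxb (neg_nonneg.1 h2)
      have hai := key a b ha hb hab hxb
      have hbi := key b a hb ha (by rw [hab, add_comm]) hxa
      rw [geomRep_mul] at hxa hxb
      refine ⟨_, _, ha.map _, hb.map _, ha.simple_nonneg ha0 hai, hb.simple_nonneg hb0 hbi, ?_,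
        hxa, hxb⟩
      rw [← map_add, ← hab, ← geomRep_mul, cs.simple_mul_simple_self, map_one,
        Module.End.one_apply]
    · have hxi := geomRep_single_nonneg cs x i hx
      have hri : IsRoot cs (Finsupp.single i 1) := isRoot_single i
      rw [geomRep_mul, h.geomRep_eq, reflMap_apply, map_sub, map_smul] at hyi
      have hs := cform_symm M v (Finsupp.single i 1)
      rcases h.cform_cases (isPosRootOf_single i) hrs with hc | hc | hc
      · rw [hc, zero_smul, sub_zero] at hyi
        exact absurd hyi ((hri.map _).not_nonpos hxi)
      · have hsv : geomRep cs (cs.simple i) v = v - Finsupp.single i 1 := by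
          rw [geomRep_simple, reflMap_apply, ← hs, hc, one_smul]
        refine ⟨Finsupp.single i 1, v - Finsupp.single i 1, hri, ?_,
          Finsupp.single_nonneg.2 zero_le_one, ?_, by abel, hxi, ?_⟩
        · rw [← hsv]; exact h.isRoot.map _
        · rw [← hsv]; exact h.isRoot.simple_nonneg h.nonneg hv
        · rw [hc, one_smul] at hyi
          rw [map_sub]
          exact sub_nonneg.2 (sub_nonpos.1 hyi)
      · rw [hc] at hyi
        refine absurd ?_ ((hri.map x).not_nonpos hxi)
        refine le_trans ?_ hyi
        simpa using hxv

/-- An edge of the Bruhat graph that is not a cover spans a Bruhat interval containing two more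
elements on each of two intermediate levels. -/
theorem BruhatStep.exists_hexagon {x y : W} (h : BruhatStep cs x y)
    (hne : cs.length y ≠ cs.length x + 1) :
    ∃ a₁ a₂ c₁ c₂, a₁ ≠ a₂ ∧ c₁ ≠ c₂ ∧ BruhatStep cs x a₁ ∧ BruhatStep cs x a₂ ∧
      BruhatStep cs a₁ c₁ ∧ BruhatStep cs a₁ c₂ ∧ BruhatStep cs a₂ c₁ ∧ BruhatStep cs a₂ c₂ ∧
      BruhatStep cs c₁ y ∧ BruhatStep cs c₂ y := by
  obtain ⟨hr, hlt⟩ := bruhatStep_iff.1 h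
  obtain ⟨v, hv⟩ := exists_isPosRootOf hr
  obtain ⟨r, hry⟩ : ∃ r, r = x⁻¹ * y := ⟨_, rfl⟩
  have hy : y = x * r := by rw [hry]; group
  rw [← hry] at hv
  subst hy
  obtain ⟨a, b, ha, hb, ha0, hb0, rfl, hxa, hxb⟩ := hv.exists_add hlt hne
  obtain ⟨t, ht⟩ := ha.exists_isPosRootOf ha0
  obtain ⟨u, hu⟩ := hb.exists_isPosRootOf hb0
  have hc : cform M a b = -1 := by
    have n0 := hv.isRoot.cform_self
    simp only [map_add, LinearMap.add_apply, ha.cform_self, hb.cform_self,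
      cform_symm M b a] at n0
    omega
  have htu : t ≠ u := by
    rintro rfl
    have h1 := ht.geomRep_self
    rw [hu.geomRep_eq, reflMap_apply, cform_symm, hc] at h1
    have h2 : b = (-2 : ℤ) • a := by linear_combination (norm := module) h1
    have h3 := hc
    rw [h2, map_smul, ha.cform_self] at h3
    norm_num at h3
  have key : ∀ {a b : B →₀ ℤ} {t u : W}, IsPosRootOf cs a t → IsPosRootOf cs b u →
      IsPosRootOf cs (a + b) r → cform M a b = -1 → 0 ≤ geomRep cs x a → 0 ≤ geomRep cs x b →
      r = t * u * t ∧ BruhatStep cs x (x * t) ∧ BruhatStep cs (x * t) (x * t * u) ∧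
      BruhatStep cs (x * t) (x * t * r) ∧ BruhatStep cs (x * t * u) (x * t * u * t) := by
    intro a b t u ht hu hr hc hxa hxb
    have na := ht.isRoot.cform_self
    have nb := hu.isRoot.cform_self
    have hba := cform_symm M b a
    refine ⟨geomRep_injective cs ?_, ht.bruhatStep hxa, hu.bruhatStep ?_, hr.bruhatStep ?_,
      ht.bruhatStep ?_⟩
    · rw [hr.geomRep_eq, ht.conj_eq hu, hc]
      congr 1
      module
    · rw [geomRep_mul, ht.geomRep_eq, reflMap_apply, hc, neg_smul, one_smul, sub_neg_eq_add,
        map_add]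
      exact add_nonneg hxb hxa
    · convert hxb using 1
      rw [geomRep_mul, ht.geomRep_eq, reflMap_apply, map_add, na, hc]
      congr 1
      module
    · convert hxb using 1
      rw [geomRep_mul, geomRep_mul, hu.geomRep_eq, ht.geomRep_eq]
      congr 1
      simp only [reflMap_apply, map_sub, map_smul, na, hba, hc]
      module
  obtain ⟨e1, s1, s2, s3, s4⟩ := key ht hu hv hc hxa hxb
  obtain ⟨e2, s1', s2', s3', s4'⟩ := key hu ht (by rwa [add_comm]) (by rw [cform_symm, hc]) hxb hxa
  have f1 : x * t * r = x * u * t := by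
    have : t * r = u * t := by
      rw [e1, ← mul_assoc, ← mul_assoc, ht.isReflection.mul_self, one_mul]
    rw [mul_assoc, this, mul_assoc]
  have f2 : x * u * r = x * t * u := by
    have : u * r = t * u := by
      rw [e2, ← mul_assoc, ← mul_assoc, hu.isReflection.mul_self, one_mul]
    rw [mul_assoc, this, mul_assoc]
  refine ⟨x * t, x * u, x * t * u, x * u * t, by simpa using htu, ?_, s1, s1', s2, f1 ▸ s3,
    f2 ▸ s3', s2', ?_, ?_⟩
  · intro h
    have h1 : t * u = u * t := by simpa [mul_assoc] using h
    have h2 : t = u := by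
      have e := e2
      rw [e1, h1, mul_assoc, ht.isReflection.mul_self, mul_one, mul_assoc, h1, ← mul_assoc,
        hu.isReflection.mul_self, one_mul] at e
      exact e.symm
    exact htu h2
  · simpa [e1, mul_assoc] using s4
  · simpa [e2, mul_assoc] using s4'

/-- Bruhat paths of length two come in pairs. -/
theorem BruhatStep.exists_diamond {b a c : W} (hba : BruhatStep cs b a) (hac : BruhatStep cs a c) :
    ∃ a', a' ≠ a ∧ BruhatStep cs b a' ∧ BruhatStep cs a' c := by
  obtain ⟨ht, hlt⟩ := bruhatStep_iff.1 hba
  obtain ⟨hu, hlu⟩ := bruhatStep_iff.1 hac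
  obtain ⟨α, hα⟩ := exists_isPosRootOf ht
  obtain ⟨β, hβ⟩ := exists_isPosRootOf hu
  obtain ⟨t, et⟩ : ∃ t, t = b⁻¹ * a := ⟨_, rfl⟩
  obtain ⟨u, eu⟩ : ∃ u, u = a⁻¹ * c := ⟨_, rfl⟩
  have ea : a = b * t := by rw [et]; group
  have ec : c = a * u := by rw [eu]; group
  rw [← et] at ht hα
  rw [← eu] at hu hβ
  clear et eu
  subst ec
  subst ea
  have htu : t ≠ u := by
    rintro rfl
    rw [mul_assoc, ht.mul_self, mul_one] at hlu
    omega
  have hbα := hα.length_lt_iff.1 hlt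
  have hbβ := hβ.length_lt_iff.1 hlu
  have nα := hα.isRoot.cform_self
  have nβ := hβ.isRoot.cform_self
  have hs := cform_symm M β α
  rw [geomRep_mul, hα.geomRep_eq, reflMap_apply] at hbβ
  have hqt : t * u * t ≠ t := fun h => htu (by
    have : t * u = 1 := by simpa using h
    rw [← inv_eq_of_mul_eq_one_right this, ht.inv])
  have hq : IsRoot cs (β - cform M α β • α) := by
    rw [← reflMap_apply, ← hα.geomRep_eq]
    exact hβ.isRoot.map t
  have hconj := hα.conj_eq hβ
  have ec1 : b * (t * u * t) * t = b * t * u := by simp [mul_assoc, ht.mul_self]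
  rcases hα.cform_cases hβ htu with hc | hc | hc
  · refine ⟨b * u, by simpa using htu.symm, hβ.bruhatStep (by simpa [hc] using hbβ), ?_⟩
    rw [mul_assoc, hα.commute hβ hc, ← mul_assoc]
    refine hα.bruhatStep ?_
    rw [geomRep_mul, hβ.geomRep_eq, reflMap_apply, hs, hc, zero_smul, sub_zero]
    exact hbα
  all_goals
    have hbr := hα.braid hβ (by omega)
    rw [hc] at hbβ hconj hq
    have ec2 : b * u * (t * u * t) = b * t * u := by
      rw [hbr]; simp only [← mul_assoc]
      rw [mul_assoc b u u, hu.mul_self, mul_one]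
    rw [hc] at hs
  · by_cases h0 : 0 ≤ β - (1 : ℤ) • α
    · have hqq : IsPosRootOf cs _ (t * u * t) := ⟨h0, hq, hconj⟩
      refine ⟨b * (t * u * t), by simpa using hqt, hqq.bruhatStep hbβ, ?_⟩
      rw [← ec1]
      refine hα.bruhatStep ?_
      have : geomRep cs (b * (t * u * t)) α =
          geomRep cs b (β - (1 : ℤ) • α) + geomRep cs b α := by
        rw [geomRep_mul, hconj, reflMap_apply, ← map_add]
        congr 1
        simp only [map_sub, map_smul, LinearMap.sub_apply, LinearMap.smul_apply, nα, hs]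
        module
      rw [this]
      exact add_nonneg hbβ hbα
    · have hqq : IsPosRootOf cs (-(β - (1 : ℤ) • α)) (t * u * t) :=
        ⟨neg_nonneg.2 (hq.nonpos_of_not_nonneg h0), hq.neg, by rw [hconj, reflMap_neg]⟩
      refine ⟨b * u, by simpa using htu.symm, hβ.bruhatStep ?_, ?_⟩
      · have := add_nonneg hbβ hbα
        rw [← map_add] at this
        simpa using this
      · rw [← ec2]
        refine hqq.bruhatStep ?_
        convert hbα using 1
        rw [geomRep_mul, hβ.geomRep_eq, reflMap_apply]
        congr 1
        simp only [map_neg, map_sub, map_smul, nβ, hs]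
        module
  · have hqq : IsPosRootOf cs (β - (-1 : ℤ) • α) (t * u * t) :=
      ⟨by simpa using add_nonneg hβ.nonneg hα.nonneg, hq, hconj⟩
    by_cases h0 : 0 ≤ geomRep cs b β
    · refine ⟨b * u, by simpa using htu.symm, hβ.bruhatStep h0, ?_⟩
      rw [← ec2]
      refine hqq.bruhatStep ?_
      convert hbα using 1
      rw [geomRep_mul, hβ.geomRep_eq, reflMap_apply]
      congr 1
      simp only [map_sub, map_smul, nβ, hs]
      module
    · refine ⟨b * (t * u * t), by simpa using hqt, hqq.bruhatStep hbβ, ?_⟩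
      rw [← ec1]
      refine hα.bruhatStep ?_
      have : geomRep cs (b * (t * u * t)) α = -geomRep cs b β := by
        rw [geomRep_mul, hconj, reflMap_apply, ← map_neg]
        congr 1
        simp only [map_sub, map_smul, LinearMap.sub_apply, LinearMap.smul_apply, nα, hs]
        module
      rw [this]
      exact neg_nonneg.2 ((hβ.isRoot.map b).nonpos_of_not_nonneg h0)

end LongEdges
/-! ### Special matchings and the Bruhat graph -/

section Parity

variable {cs : CoxeterSystem M W}

theorem BruhatStep.length_lt {a b : W} (h : BruhatStep cs a b) : cs.length a < cs.length b :=
  (bruhatStep_iff.1 h).2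

theorem BruhatStep.isReflection {a b : W} (h : BruhatStep cs a b) : cs.IsReflection (a⁻¹ * b) :=
  (bruhatStep_iff.1 h).1

theorem BruhatStep.le {a b : W} (h : BruhatStep cs a b) : BruhatLE cs a b :=
  Relation.ReflTransGen.single h

theorem BruhatStep.length_mod_two {a b : W} (h : BruhatStep cs a b) :
    cs.length b % 2 = (cs.length a + 1) % 2 := by
  obtain ⟨t, ht, rfl, -⟩ := h
  have h1 := cs.length_mul_mod_two t a
  have h2 := Nat.odd_iff.1 ht.odd_length
  omega

theorem isReflection_inv_mul_comm {a b : W} (h : cs.IsReflection (a⁻¹ * b)) :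
    cs.IsReflection (b⁻¹ * a) := by
  have := h.isReflection_inv
  rwa [mul_inv_rev, inv_inv] at this

theorem BruhatLE.bruhatStep {a b : W} (h : BruhatLE cs a b)
    (hl : cs.length b = cs.length a + 1) : BruhatStep cs a b := by
  rcases Relation.ReflTransGen.cases_head h with rfl | ⟨c, hc, hcb⟩
  · omega
  · by_cases hcb' : c = b
    · exact hcb' ▸ hc
    · have := BruhatLE.length_lt hcb hcb'
      have := hc.length_lt
      omega

end Parity

section SpecialMatching

variable {cs : CoxeterSystem M W}

/-- A covering relation of the Bruhat order. -/
def BruhatCover (cs : CoxeterSystem M W) (a b : W) : Prop :=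
  BruhatStep cs a b ∧ cs.length b = cs.length a + 1

/-- A map of `W` restricting to a special matching of the interval `[y,w]`. -/
structure SpecialOn (cs : CoxeterSystem M W) (y w : W) (f : W → W) : Prop where
  maps : ∀ x, BruhatLE cs y x → BruhatLE cs x w → BruhatLE cs y (f x) ∧ BruhatLE cs (f x) w
  invol : ∀ x, BruhatLE cs y x → BruhatLE cs x w → f (f x) = x
  cover : ∀ x, BruhatLE cs y x → BruhatLE cs x w → BruhatCover cs (f x) x ∨ BruhatCover cs x (f x)
  special : ∀ x z, BruhatLE cs y x → BruhatLE cs z w → BruhatCover cs x z →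
    f x = z ∨ BruhatLE cs (f x) (f z)

variable [SimplyLaced M] [Finite W] {y w : W} {f : W → W}

/-- Special matchings preserve the edges of the Bruhat graph. -/
theorem SpecialOn.isReflection (hf : SpecialOn cs y w f) {x z : W} (hx : BruhatLE cs y x)
    (hz : BruhatLE cs z w) (h : BruhatStep cs x z) : cs.IsReflection ((f x)⁻¹ * f z) := by
  generalize hn : cs.length z - cs.length x = n
  induction n using Nat.strong_induction_on generalizing x z with
  | _ n ih =>
    subst hn
    have hinj : ∀ p q, BruhatLE cs y p → BruhatLE cs p w → BruhatLE cs y q → BruhatLE cs q w →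
        p ≠ q → f p ≠ f q := fun p q h1 h2 h3 h4 hne he =>
      hne (by rw [← hf.invol p h1 h2, he, hf.invol q h3 h4])
    have hxw := h.le.trans hz
    have hyz := hx.trans h.le
    by_cases hl : cs.length z = cs.length x + 1
    · rcases hf.special x z hx hz ⟨h, hl⟩ with e | hle
      · rw [← e, hf.invol x hx hxw, e]
        exact isReflection_inv_mul_comm h.isReflection
      · have hne := hinj x z hx hxw hyz hz (fun e => by subst e; omega)
        have hlt := hle.length_lt hne
        by_cases h1 : cs.length (f z) = cs.length (f x) + 1
        · exact (hle.bruhatStep h1).isReflection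
        have hfx : BruhatCover cs (f x) x := by
          rcases hf.cover x hx hxw with c | c
          · exact c
          · rcases hf.cover z hyz hz with d | d <;> have := c.2 <;> have := d.2 <;> omega
        have hfz : BruhatCover cs z (f z) := by
          rcases hf.cover z hyz hz with d | d
          · have := hfx.2; have := d.2; omega
          · exact d
        obtain ⟨x', hx', s1, s2⟩ := hfx.1.exists_diamond h
        have l1 := hfx.2
        have l2 := hfz.2
        have l3 := s1.length_lt
        have l4 := s2.length_lt
        have hyfx := (hf.maps x hx hxw).1
        have hyx' := hyfx.trans s1.le
        have hx'w := s2.le.trans hz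
        have hxz' : BruhatLE cs x (f x') := by
          rcases hf.special (f x) x' hyfx hx'w ⟨s1, by omega⟩ with e | e
          · rw [hf.invol x hx hxw] at e
            exact absurd e.symm hx'
          · rwa [hf.invol x hx hxw] at e
        have hne' : f x' ≠ z := by
          intro e
          have : f z = x' := by rw [← e, hf.invol x' hyx' hx'w]
          rw [this] at l2
          omega
        have hz'z : BruhatLE cs (f x') (f z) :=
          (hf.special x' z hyx' hz ⟨s2, by omega⟩).resolve_left hne'
        have hne'' : x ≠ f x' := fun e => hinj (f x) x' hyfx (hf.maps x hx hxw).2 hyx' hx'w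
          (fun e => by rw [e] at l3; omega) (by rw [hf.invol x hx hxw, e])
        have l5 := hxz'.length_lt hne''
        have hz' : BruhatCover cs x' (f x') := by
          rcases hf.cover x' hyx' hx'w with c | c
          · have := c.2; omega
          · exact c
        have l6 := hz'.2
        have sz := (hxz'.bruhatStep (by omega))
        have sz' := (hz'z.bruhatStep (by omega))
        exact isReflection_of_hexagon hfx.1.isReflection s1.isReflection h.isReflection
          sz.isReflection s2.isReflection hz'.1.isReflection hfz.1.isReflection sz'.isReflection
          hx'.symm hne'.symm (fun e => by rw [e] at l1; omega) (fun e => by rw [e] at l1; omega)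
          (fun e => by rw [e] at l2; omega)
    · obtain ⟨a₁, a₂, c₁, c₂, ha, hc, s1, s2, s11, s12, s21, s22, t1, t2⟩ :=
        h.exists_hexagon hl
      have := s1.length_lt
      have := s2.length_lt
      have := s11.length_lt
      have := s12.length_lt
      have := s21.length_lt
      have := s22.length_lt
      have := t1.length_lt
      have := t2.length_lt
      have ha₁ := hx.trans s1.le
      have ha₂ := hx.trans s2.le
      have hc₁ := ha₁.trans s11.le
      have hc₂ := ha₁.trans s12.le
      have hc₁w := t1.le.trans hz
      have hc₂w := t2.le.trans hz
      have ha₁w := s11.le.trans hc₁w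
      have ha₂w := s21.le.trans hc₁w
      exact isReflection_of_hexagon
        (ih _ (by omega) hx ha₁w s1 rfl) (ih _ (by omega) hx ha₂w s2 rfl)
        (ih _ (by omega) ha₁ hc₁w s11 rfl) (ih _ (by omega) ha₁ hc₂w s12 rfl)
        (ih _ (by omega) ha₂ hc₁w s21 rfl) (ih _ (by omega) ha₂ hc₂w s22 rfl)
        (ih _ (by omega) hc₁ hz t1 rfl) (ih _ (by omega) hc₂ hz t2 rfl)
        (hinj _ _ ha₁ ha₁w ha₂ ha₂w ha) (hinj _ _ hc₁ hc₁w hc₂ hc₂w hc)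
        (hinj _ _ hx hxw hc₁ hc₁w (fun e => by subst e; omega))
        (hinj _ _ hx hxw hc₂ hc₂w (fun e => by subst e; omega))
        (hinj _ _ hyz hz ha₁ ha₁w (fun e => by subst e; omega))

/-- A special matching of `[y,w]` expresses the degree of `y` through that of its partner. -/
theorem SpecialOn.bruhatDeg_eq (hf : SpecialOn cs y w f) (hyw : BruhatLE cs y w) :
    BruhatCover cs y (f y) ∧ bruhatDeg cs y w y = bruhatDeg cs (f y) w (f y) + 1 := by
  have hyy : BruhatLE cs y y := Relation.ReflTransGen.refl
  obtain ⟨hy1, hy1w⟩ := hf.maps y hyy hyw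
  have hc : BruhatCover cs y (f y) := by
    rcases hf.cover y hyy hyw with c | c
    · have := hy1.length_le
      have := c.2
      omega
    · exact c
  refine ⟨hc, ?_⟩
  have hlc := hc.2
  have step : ∀ {a b : W}, BruhatLE cs a b → cs.IsReflection (a⁻¹ * b) → BruhatStep cs a b := by
    intro a b hle hr
    refine bruhatStep_iff.2 ⟨hr, hle.length_lt ?_⟩
    rintro rfl
    have := hr.odd_length
    simp at this
  let A : W → Set W := fun v =>
    {z | (BruhatLE cs v z ∧ BruhatLE cs z w) ∧ cs.IsReflection (v⁻¹ * z)}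
  have hA : A y = insert (f y) (f '' A (f y)) := by
    ext z
    constructor
    · rintro ⟨⟨hyz, hzw⟩, hr⟩
      by_cases hz : z = f y
      · exact Or.inl hz
      right
      have hs := step hyz hr
      have hm := hf.maps z hyz hzw
      refine ⟨f z, ⟨⟨?_, hm.2⟩, hf.isReflection hyy hzw hs⟩, hf.invol z hyz hzw⟩
      by_cases hl : cs.length z = cs.length y + 1
      · exact (hf.special y z hyy hzw ⟨hs, hl⟩).resolve_left (fun e => hz e.symm)
      · have h1 := hs.length_lt
        have h2 := hs.length_mod_two
        refine (bruhatStep_iff.2 ⟨hf.isReflection hyy hzw hs, ?_⟩ : BruhatStep cs _ _).le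
        rcases hf.cover z hyz hzw with c | c <;> have := c.2 <;> omega
    · rintro (rfl | ⟨z, ⟨⟨hyz, hzw⟩, hr⟩, rfl⟩)
      · exact ⟨⟨hy1, hy1w⟩, hc.1.isReflection⟩
      · have hm := hf.maps z (hy1.trans hyz) hzw
        refine ⟨hm, ?_⟩
        have := hf.isReflection hy1 hzw (step hyz hr)
        rwa [hf.invol y hyy hyw] at this
  have hnot : f y ∉ f '' A (f y) := by
    rintro ⟨z, ⟨⟨hyz, hzw⟩, -⟩, e⟩
    have hzy : z = y := by
      rw [← hf.invol z (hy1.trans hyz) hzw, e, hf.invol y hyy hyw]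
    subst hzy
    have := hyz.length_le
    omega
  have hinj : Set.InjOn f (A (f y)) := fun a ha b hb e => by
    rw [← hf.invol a (hy1.trans ha.1.1) ha.1.2, e, hf.invol b (hy1.trans hb.1.1) hb.1.2]
  change (A y).ncard = (A (f y)).ncard + 1
  rw [hA, Set.ncard_insert_of_notMem hnot (Set.toFinite _), hinj.ncard_image]

theorem rationallySmooth_of_specialOn {u w : W}
    (h : ∀ y, BruhatLE cs u y → BruhatLE cs y w → y ≠ w → ∃ f, SpecialOn cs y w f) :
    RationallySmooth cs u w := by
  intro y huy hyw
  generalize hn : cs.length w - cs.length y = n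
  induction n generalizing y with
  | zero =>
    have hy : y = w := by
      by_contra hne
      have := hyw.length_lt hne
      omega
    subst hy
    refine Nat.card_eq_zero.2 (Or.inl ⟨?_⟩)
    rintro ⟨z, ⟨h1, h2⟩, hr⟩
    obtain rfl := h1.antisymm h2
    have := hr.odd_length
    simp at this
  | succ n ih =>
    obtain ⟨f, hf⟩ := h y huy hyw (by rintro rfl; omega)
    obtain ⟨hc, hd⟩ := hf.bruhatDeg_eq hyw
    have hm := hf.maps y Relation.ReflTransGen.refl hyw
    have := hc.2
    rw [hd, ih (f y) (huy.trans hm.1) hm.2 (by omega)]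

end SpecialMatching
section ZirconSmooth

variable [SimplyLaced M] [Finite W] {cs : CoxeterSystem M W}

/-- A special matching of the ideal of `y` in the dual of `[u,w]` is one of `[y,w]`. -/
theorem exists_specialOn {u w y : W} (huy : BruhatLE cs u y) (hyw : BruhatLE cs y w)
    {f : {v : (BruhatInterval cs u w)ᵒᵈ // v ≤ OrderDual.toDual ⟨y, huy, hyw⟩} →
      {v : (BruhatInterval cs u w)ᵒᵈ // v ≤ OrderDual.toDual ⟨y, huy, hyw⟩}}
    (hf : IsSpecialMatching f) : ∃ g, SpecialOn cs y w g := by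
  classical
  obtain ⟨⟨hinv, hcov⟩, hsp⟩ := hf
  let P := {v : (BruhatInterval cs u w)ᵒᵈ // v ≤ OrderDual.toDual ⟨y, huy, hyw⟩}
  let val : P → W := fun p => (OrderDual.ofDual p.1).1
  let mk : (z : W) → BruhatLE cs y z → BruhatLE cs z w → P := fun z h1 h2 =>
    ⟨OrderDual.toDual ⟨z, huy.trans h1, h2⟩, h1⟩
  have hle : ∀ p q : P, p ≤ q ↔ BruhatLE cs (val q) (val p) := fun p q => Iff.rfl
  have hval : ∀ p q : P, val p = val q → p = q := fun p q h =>
    Subtype.ext (OrderDual.ofDual.injective (Subtype.ext h))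
  have hy : ∀ p : P, BruhatLE cs y (val p) := fun p => p.2
  have hw : ∀ p : P, BruhatLE cs (val p) w := fun p => (OrderDual.ofDual p.1).2.2
  have hlt : ∀ p q : P, BruhatStep cs (val q) (val p) → p < q := by
    intro p q h
    refine lt_of_le_of_ne ((hle p q).2 h.le) ?_
    rintro rfl
    exact lt_irrefl _ h.length_lt
  have hcover : ∀ p q : P, p ⋖ q ↔ BruhatCover cs (val q) (val p) := by
    intro p q
    constructor
    · intro h
      have between : ∀ c, BruhatStep cs (val q) c → BruhatLE cs c (val p) → c = val p := by
        intro c h1 h2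
        by_contra hne
        have hpc : p < mk c ((hy q).trans h1.le) (h2.trans (hw p)) :=
          lt_of_le_of_ne ((hle _ _).2 h2) (fun e => hne (congrArg val e).symm)
        exact h.2 hpc (hlt _ _ h1)
      rcases Relation.ReflTransGen.cases_head ((hle p q).1 h.1.le) with e | ⟨c, hc, hcp⟩
      · exact absurd (hval _ _ e).symm h.1.ne
      · obtain rfl := between c hc hcp
        refine ⟨hc, ?_⟩
        by_contra hl
        obtain ⟨a, -, d, -, -, -, s, -, t, -, -, -, t', -⟩ := hc.exists_hexagon hl
        have e := between a s (t.le.trans t'.le)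
        have := t.length_lt
        have := t'.length_lt
        subst e
        omega
    · rintro ⟨hs, hl⟩
      refine ⟨hlt _ _ hs, fun c h1 h2 => ?_⟩
      have l1 := BruhatLE.length_lt ((hle _ _).1 h1.le) fun e => h1.ne (hval _ _ e).symm
      have l2 := BruhatLE.length_lt ((hle _ _).1 h2.le) fun e => h2.ne (hval _ _ e).symm
      omega
  let g : W → W := fun z => if h : BruhatLE cs y z ∧ BruhatLE cs z w then val (f (mk z h.1 h.2))
    else z
  have hg : ∀ z h1 h2, g z = val (f (mk z h1 h2)) := fun z h1 h2 => dif_pos ⟨h1, h2⟩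
  have hgp : ∀ p, g (val p) = val (f p) := fun p => hg _ (hy p) (hw p)
  refine ⟨g, ?_, ?_, ?_, ?_⟩
  · intro x h1 h2
    rw [hg x h1 h2]
    exact ⟨hy _, hw _⟩
  · intro x h1 h2
    rw [hg x h1 h2, hgp, hinv]
    rfl
  · intro x h1 h2
    rw [hg x h1 h2]
    exact (hcov (mk x h1 h2)).symm.imp (hcover _ _).1 (hcover _ _).1
  · intro x z h1 h2 hxz
    have h3 := hxz.1.le.trans h2
    have h4 := h1.trans hxz.1.le
    rw [hg x h1 h3, hg z h4 h2]
    rcases hsp (mk z h4 h2) (mk x h1 h3) ((hcover _ _).2 hxz) with e | e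
    · left
      rw [← e, hinv]
      rfl
    · exact Or.inr ((hle _ _).1 e.le)

theorem rationallySmooth_of_isZircon {u w : W}
    (h : IsZircon ((BruhatInterval cs u w)ᵒᵈ)) : RationallySmooth cs u w := by
  refine rationallySmooth_of_specialOn fun y huy hyw hne => ?_
  obtain ⟨-, f, hf⟩ := h (OrderDual.toDual ⟨y, huy, hyw⟩)
    ⟨OrderDual.toDual ⟨w, huy.trans hyw, Relation.ReflTransGen.refl⟩,
      lt_of_le_of_ne hyw fun e => hne (congrArg (fun p => (OrderDual.ofDual p).1) e).symm⟩
  exact exists_specialOn huy hyw hf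

end ZirconSmooth

/-! ### Duality by the longest element -/

section Longest

variable [SimplyLaced M] {cs : CoxeterSystem M W}

/-- Left multiplication by an element of maximal length reverses the Bruhat order. -/
theorem BruhatLE.longest_mul {w₀ : W} (hw₀ : ∀ x, cs.length x ≤ cs.length w₀) {x y : W}
    (h : BruhatLE cs x y) : BruhatLE cs (w₀ * y) (w₀ * x) := by
  have hneg : ∀ v : B →₀ ℤ, 0 ≤ v → geomRep cs w₀ v ≤ 0 := by
    intro v hv
    have : v = v.sum fun i c => c • Finsupp.single i (1 : ℤ) := by
      simp
    rw [this, Finsupp.sum, map_sum]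
    refine Finset.sum_nonpos fun i _ => ?_
    rw [map_smul]
    refine smul_nonpos_of_nonneg_of_nonpos (hv i) (geomRep_single_nonpos cs w₀ i ?_)
    exact lt_of_le_of_ne (hw₀ _) (cs.length_mul_simple_ne w₀ i)
  induction h with
  | refl => exact Relation.ReflTransGen.refl
  | @tail a b _ hs ih =>
    refine Relation.ReflTransGen.trans ?_ ih
    obtain ⟨ht, hlt⟩ := bruhatStep_iff.1 hs
    obtain ⟨v, hv⟩ := exists_isPosRootOf ht
    refine (bruhatStep_iff.2 ⟨?_, ?_⟩ : BruhatStep cs _ _).le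
    · rw [show (w₀ * b)⁻¹ * (w₀ * a) = b⁻¹ * a by group]
      exact isReflection_inv_mul_comm ht
    · have := hv.length_lt_of_nonpos (w := w₀ * a) (by
        rw [geomRep_mul]
        exact hneg _ (hv.length_lt_iff.1 (by simpa using hlt)))
      simpa [mul_assoc] using this

theorem exists_dual_iso [Finite W] (u w : W) :
    ∃ w₀ : W, (∀ {x y : W}, BruhatLE cs x y → BruhatLE cs (w₀ * y) (w₀ * x)) ∧
      Nonempty ((BruhatInterval cs u w)ᵒᵈ ≃o BruhatInterval cs (w₀ * w) (w₀ * u)) := by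
  obtain ⟨w₀, hw₀⟩ := Finite.exists_max cs.length
  have h1 : ∀ {x y : W}, BruhatLE cs x y → BruhatLE cs (w₀ * y) (w₀ * x) :=
    fun h => h.longest_mul hw₀
  have h2 : ∀ {x y : W}, BruhatLE cs x y → BruhatLE cs (w₀⁻¹ * y) (w₀⁻¹ * x) :=
    fun h => h.longest_mul fun x => by rw [cs.length_inv]; exact hw₀ x
  refine ⟨w₀, h1, ⟨{
    toFun := fun p => ⟨w₀ * (OrderDual.ofDual p).1, h1 (OrderDual.ofDual p).2.2,
      h1 (OrderDual.ofDual p).2.1⟩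
    invFun := fun p => OrderDual.toDual ⟨w₀⁻¹ * p.1, by simpa using h2 p.2.2,
      by simpa using h2 p.2.1⟩
    left_inv := fun p => by simp
    right_inv := fun p => by simp
    map_rel_iff' := ⟨fun h => ?_, fun h => h1 h⟩ }⟩⟩
  have := h2 h
  simp only [Equiv.coe_fn_mk, inv_mul_cancel_left] at this
  exact this

end Longest

/-- Let `W` be a simply laced Weyl group. If (i) every Bruhat interval in
`W` which is a zircon is isomorphic to a lower Bruhat interval in some Weyl group, and
(ii) the dual of every rationally smooth Bruhat interval in `W` is a zircon, then for
`u < w` in `W`: `[u,w]*` is a zircon iff `[u,w]*` is isomorphic to a lower Bruhat interval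
in some Weyl group iff `[u,w]` is rationally smooth. -/
theorem tfae_zircon_lower_smooth
    {B W : Type*} [Group W] [Finite W] {M : CoxeterMatrix B} (cs : CoxeterSystem M W)
    (hsl : ∀ i j : B, i ≠ j → M i j ∈ ({2, 3} : Set ℕ))
    (h1 : ∀ u w : W, BruhatLE cs u w → u ≠ w → IsZircon (BruhatInterval cs u w) →
      IsoToLowerWeylInterval (BruhatInterval cs u w))
    (h2 : ∀ u w : W, BruhatLE cs u w → u ≠ w → RationallySmooth cs u w →
      IsZircon ((BruhatInterval cs u w)ᵒᵈ))
    (u w : W) (huw : BruhatLE cs u w) (hne : u ≠ w) :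
    List.TFAE [IsZircon ((BruhatInterval cs u w)ᵒᵈ),
      IsoToLowerWeylInterval ((BruhatInterval cs u w)ᵒᵈ),
      RationallySmooth cs u w] := by
  have : SimplyLaced M := ⟨hsl⟩
  tfae_have 1 → 2 := by
    intro hz
    obtain ⟨w₀, hw₀, ⟨e⟩⟩ := exists_dual_iso (cs := cs) u w
    obtain ⟨D, x, hx, ⟨e'⟩⟩ := h1 (w₀ * w) (w₀ * u) (hw₀ huw) (by simpa using hne.symm)
      (hz.of_orderIso e)
    exact ⟨D, x, hx, ⟨e.trans e'⟩⟩
  tfae_have 2 → 1 := by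
    rintro ⟨D, x, -, ⟨e⟩⟩
    exact (isZircon_lower D.cs x).of_orderIso e.symm
  tfae_have 1 → 3 := rationallySmooth_of_isZircon
  tfae_have 3 → 1 := h2 u w huw hne
  tfae_finish

end Paper
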